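/- arXiv:2110.04324 — 4 statements merged into one kernel-verified Lean document; each statement's English description precedes it below -/
import Mathlib

section
/- Let K be a convex body in Euclidean 3-space ℝ³. Suppose that for every plane H ⊆ ℝ³, the section H ∩ K is centrally symmetric (with the convention that the empty set is symmetric). Then K is an ellipsoid. -/
/-- A set is centrally symmetric with center `c` if its reflection through `c` equals itself.
Note the empty set satisfies this for any `c`, matching the convention that ∅ is symmetric. -/
def SymmWith (A : Set (EuclideanSpace ℝ (Fin 3))) (c : EuclideanSpace ℝ (Fin 3)) : Prop :=
  (fun x => (2 : ℝ) • c - x) '' A = A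

section AffineReflections
open Set Filter Topology

/-- In finite dimension the convex hull of a compact set is compact. -/
theorem IsCompact.convexHull_of_finiteDimensional {V : Type*} [NormedAddCommGroup V]
    [NormedSpace ℝ V] [FiniteDimensional ℝ V] {Z : Set V} (hZ : IsCompact Z) :
    IsCompact (convexHull ℝ Z) := by
  rcases Z.eq_empty_or_nonempty with rfl | ⟨z₀, hz₀⟩
  · simp
  let n := Module.finrank ℝ V + 1
  let D : Set ((Fin n → ℝ) × (Fin n → V)) := stdSimplex ℝ (Fin n) ×ˢ Set.univ.pi fun _ => Z
  have hD : IsCompact D := (isCompact_stdSimplex ℝ (Fin n)).prod (isCompact_univ_pi fun _ => hZ)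
  have hcont : Continuous fun p : (Fin n → ℝ) × (Fin n → V) => ∑ i, p.1 i • p.2 i := by fun_prop
  convert hD.image hcont using 1
  apply Subset.antisymm
  · intro x hx
    obtain ⟨ι, _, z, w, hz, hind, hw, hw1, rfl⟩ := eq_pos_convex_span_of_mem_convexHull hx
    have hcard : Fintype.card ι ≤ Fintype.card (Fin n) := by
      have := hind.card_le_finrank_succ
      have h2 := Submodule.finrank_le (vectorSpan ℝ (Set.range z))
      simp only [Fintype.card_fin, n]; omega
    obtain ⟨e⟩ := Function.Embedding.nonempty_of_card_le hcard
    have hout : ∀ j, j ∉ Set.range e → Function.extend e w 0 j = 0 := fun j hj =>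
      Function.extend_apply' _ _ _ hj
    refine ⟨(Function.extend e w 0, Function.extend e z fun _ => z₀), ⟨⟨?_, ?_⟩, ?_⟩, ?_⟩
    · intro j
      by_cases hj : j ∈ Set.range e
      · obtain ⟨i, rfl⟩ := hj
        simpa [e.injective.extend_apply] using (hw i).le
      · simp [hout j hj]
    · rw [← hw1]
      exact (Fintype.sum_of_injective e e.injective _ _ (fun j hj => hout j hj)
        (fun i => (e.injective.extend_apply _ _ i).symm)).symm
    · intro j _
      by_cases hj : j ∈ Set.range e
      · obtain ⟨i, rfl⟩ := hj
        simpa [e.injective.extend_apply] using hz ⟨i, rfl⟩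
      · simpa [Function.extend_apply' _ _ _ hj] using hz₀
    · refine (Fintype.sum_of_injective e e.injective _ _ (fun j hj => ?_) (fun i => ?_)).symm
      · simp [hout j hj]
      · simp [e.injective.extend_apply]
  · rintro _ ⟨⟨w, z⟩, ⟨⟨hw0, hw1⟩, hz⟩, rfl⟩
    exact (convex_convexHull ℝ Z).sum_mem (fun i _ => hw0 i) hw1
      fun i _ => subset_convexHull ℝ Z (hz i trivial)

/-- The line through `p` and `q` meets `P` only between the points `p` and `q` of `P`. -/
def IsMaximalChord {W : Type*} [AddCommGroup W] [Module ℝ W] (P : Set W) (p q : W) : Prop :=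
  p ∈ P ∧ q ∈ P ∧ ∀ t : ℝ, p + t • (q - p) ∈ P → 0 ≤ t ∧ t ≤ 1

section Planar
variable {W : Type*} [NormedAddCommGroup W] [NormedSpace ℝ W] {P : Set W}

theorem isMaximalChord_of_interior (hc : Convex ℝ P) (hcl : IsClosed P) {p q : W}
    (hp : p ∈ frontier P) (hq : q ∈ frontier P) {l : ℝ} (hl0 : 0 < l) (hl1 : l < 1)
    (hi : p + l • (q - p) ∈ interior P) : IsMaximalChord P p q := by
  refine ⟨hcl.frontier_subset hp, hcl.frontier_subset hq, fun t ht => ⟨?_, ?_⟩⟩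
  · by_contra! h
    refine hp.2 ?_
    have := hc.combo_interior_self_mem_interior hi ht (a := -t / (l - t)) (b := l / (l - t))
      (div_pos (by linarith) (by linarith)) (div_nonneg hl0.le (by linarith))
      (by rw [← add_div, div_eq_one_iff_eq] <;> linarith)
    convert this using 1
    have h1 : l - t ≠ 0 := by linarith
    match_scalars <;> field_simp <;> ring
  · by_contra! h
    refine hq.2 ?_
    have := hc.combo_interior_self_mem_interior hi ht (a := (t - 1) / (t - l))
      (b := (1 - l) / (t - l))
      (div_pos (by linarith) (by linarith)) (div_nonneg (by linarith) (by linarith))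
      (by rw [← add_div, div_eq_one_iff_eq] <;> linarith)
    convert this using 1
    have h1 : t - l ≠ 0 := by linarith
    match_scalars <;> field_simp <;> ring

theorem exists_frontier_beyond (hb : Bornology.IsBounded P) {p o : W}
    (ho : o ∈ interior P) (hpo : o ≠ p) :
    ∃ r ∈ frontier P, ∃ l : ℝ, 0 < l ∧ l < 1 ∧ o = p + l • (r - p) := by
  obtain ⟨R, hR⟩ := hb.subset_ball p
  have hn : 0 < ‖o - p‖ := norm_pos_iff.2 (sub_ne_zero.2 hpo)
  have hR0 : 0 < R := by
    have := hR (interior_subset ho)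
    rw [mem_ball_iff_norm] at this; linarith
  let g : ℝ → W := fun t => p + t • (o - p)
  have hg : Continuous g := by fun_prop
  have hconn : IsPreconnected (g '' Ici 1) := isPreconnected_Ici.image _ hg.continuousOn
  have hy : g (1 + R / ‖o - p‖) ∉ P := by
    intro h
    have := hR h
    rw [mem_ball_iff_norm] at this
    simp only [g, add_sub_cancel_left, norm_smul, Real.norm_eq_abs] at this
    rw [abs_of_pos (by positivity)] at this
    field_simp at this
    linarith
  have h1 : g 1 = o := by simp [g]
  obtain ⟨t, ht, hr⟩ : ∃ t ∈ Ici (1 : ℝ), g t ∈ frontier P := by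
    by_contra! hno
    have hsub := hconn.subset_left_of_subset_union isOpen_interior
      isClosed_closure.isOpen_compl
      (disjoint_compl_right_iff_subset.2 (interior_subset.trans subset_closure))
      (by
        rintro _ ⟨t, ht, rfl⟩
        by_cases h : g t ∈ closure P
        · exact Or.inl (by_contra fun h' => hno t ht ⟨h, h'⟩)
        · exact Or.inr h)
      (show (g '' Ici 1 ∩ interior P).Nonempty from ⟨o, ⟨1, self_mem_Ici, h1⟩, ho⟩)
    have hmem : 1 + R / ‖o - p‖ ∈ Ici (1 : ℝ) := by simp; positivity
    exact hy (interior_subset (hsub (mem_image_of_mem g hmem)))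
  have ht1 : 1 < t := lt_of_le_of_ne ht (by rintro rfl; rw [h1] at hr; exact hr.2 ho)
  refine ⟨g t, hr, t⁻¹, by positivity, inv_lt_one_of_one_lt₀ ht1, ?_⟩
  have : t ≠ 0 := by linarith
  simp [g, this]

theorem exists_frontier_midpoint (hW : Module.finrank ℝ W = 2) (hc : Convex ℝ P)
    (hb : Bornology.IsBounded P) {z : W} (hz : z ∈ interior P) :
    ∃ x ∈ frontier P, ∃ y ∈ frontier P, x + y = (2 : ℝ) • z := by
  let Q : Set W := (z + ·) ⁻¹' P
  have hQc : Convex ℝ Q := hc.translate_preimage_right z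
  have hQ0 : Q ∈ 𝓝 (0 : W) := by
    have hcn : ContinuousAt (z + ·) (0 : W) := by fun_prop
    exact hcn.preimage_mem_nhds (by simpa using mem_interior_iff_mem_nhds.1 hz)
  have hQb : Bornology.IsBounded Q := by
    have := hb.vadd (-z)
    refine this.subset fun x hx => ?_
    exact ⟨z + x, hx, by simp⟩
  have hfr : ∀ x, gauge Q x = 1 → z + x ∈ frontier P := by
    intro x hx
    rw [gauge_eq_one_iff_mem_frontier hQc hQ0] at hx
    have := (Homeomorph.addLeft z).preimage_frontier P
    have h2 : x ∈ (Homeomorph.addLeft z) ⁻¹' frontier P := by rw [this]; exact hx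
    exact h2
  have hpos : ∀ x, x ≠ 0 → 0 < gauge Q x := fun x hx =>
    (gauge_pos (absorbent_nhds_zero hQ0) (NormedSpace.isVonNBounded_iff ℝ |>.2 hQb)).2 hx
  have hgc := continuous_gauge hQc hQ0
  have hrank : 1 < Module.rank ℝ W := by
    have := Module.finite_of_finrank_pos (R := ℝ) (M := W) (by omega)
    rw [← Module.finrank_eq_rank ℝ W, hW]
    norm_num
  have hconn := isPreconnected_sphere hrank (0 : W) 1
  have : Nontrivial W := Module.nontrivial_of_finrank_pos (R := ℝ) (by omega)
  obtain ⟨u, hu⟩ := exists_norm_eq W zero_le_one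
  have hu' : u ∈ Metric.sphere (0 : W) 1 := by simpa using hu
  have hnu' : -u ∈ Metric.sphere (0 : W) 1 := by simpa using hu
  obtain ⟨d, hd, hd0⟩ : ∃ d ∈ Metric.sphere (0 : W) 1, gauge Q d - gauge Q (-d) = 0 := by
    have hgc2 : ContinuousOn (fun d => gauge Q d - gauge Q (-d)) (Metric.sphere (0 : W) 1) := by
      fun_prop
    rcases le_total (gauge Q u) (gauge Q (-u)) with h | h
    · exact hconn.intermediate_value hu' hnu' hgc2 ⟨by linarith, by simp; linarith⟩
    · exact hconn.intermediate_value hnu' hu' hgc2 ⟨by simp; linarith, by linarith⟩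
  have hdn : d ≠ 0 := by rintro rfl; simp at hd
  have hg0 := hpos d hdn
  have hg2 : gauge Q (-d) = gauge Q d := by linarith
  refine ⟨z + (gauge Q d)⁻¹ • d, hfr _ ?_, z + (gauge Q d)⁻¹ • (-d), hfr _ ?_, ?_⟩
  · rw [gauge_smul_of_nonneg (by positivity), smul_eq_mul, inv_mul_cancel₀ hg0.ne']
  · rw [gauge_smul_of_nonneg (by positivity), smul_eq_mul, hg2, inv_mul_cancel₀ hg0.ne']
  · module
end Planar

section Minimax
variable {E W : Type*} [NormedAddCommGroup E] [NormedSpace ℝ E] [FiniteDimensional ℝ E]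
  [NormedAddCommGroup W] [NormedSpace ℝ W] [FiniteDimensional ℝ W]

theorem exists_minimal_slab {X : Set E} (hX : IsCompact X) {v : E} (hv : v ≠ 0) :
    ∃ (a : E →L[ℝ] ℝ) (b M : ℝ), a v = 1 ∧ 0 ≤ M ∧ (∀ p ∈ X, |a p + b| ≤ M) ∧
      ∀ (a' : E →L[ℝ] ℝ) (b' : ℝ), a' v = 1 → 0 < M → ∃ p ∈ X, M ≤ |a' p + b'| := by
  have : CompactSpace X := isCompact_iff_compactSpace.1 hX
  let F : (E →L[ℝ] ℝ) × ℝ →ₗ[ℝ] C(X, ℝ) :=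
    { toFun := fun q => ⟨fun p => q.1 p + q.2, by fun_prop⟩
      map_add' := fun q r => by ext p; simp; ring
      map_smul' := fun c q => by ext p; simp; ring }
  let V := LinearMap.range F
  let ev : (E →L[ℝ] ℝ) × ℝ →ₗ[ℝ] ℝ :=
    { toFun := fun q => q.1 v
      map_add' := fun q r => by simp
      map_smul' := fun c q => by simp }
  obtain ⟨a₀, ha₀⟩ := SeparatingDual.exists_eq_one (R := ℝ) hv
  let s : AffineSubspace ℝ ((E →L[ℝ] ℝ) × ℝ) := AffineSubspace.mk' (a₀, 0) (LinearMap.ker ev)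
  have hs : ∀ q, q ∈ s ↔ q.1 v = 1 := by
    intro q
    simp only [s, AffineSubspace.mem_mk', vsub_eq_sub, LinearMap.mem_ker]
    simp [ev, ha₀, sub_eq_zero]
  let s' : AffineSubspace ℝ V := s.map F.rangeRestrict.toAffineMap
  have hcl : IsClosed (s' : Set V) := by
    have : FiniteDimensional ℝ s'.direction := inferInstance
    exact AffineSubspace.closed_of_finiteDimensional (𝕜 := ℝ) (E := V) (P := V) s'
  have hne : (s' : Set V).Nonempty := ⟨_, ⟨(a₀, 0), (hs _).2 ha₀, rfl⟩⟩
  obtain ⟨y, hy, hmin⟩ := hcl.exists_infDist_eq_dist hne 0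
  obtain ⟨⟨a, b⟩, hab, rfl⟩ := hy
  refine ⟨a, b, ‖F (a, b)‖, (hs _).1 hab, norm_nonneg _, fun p hp => ?_, fun a' b' ha' hM => ?_⟩
  · exact (F (a, b)).norm_coe_le_norm ⟨p, hp⟩
  · by_contra! hlt
    have h1 : ‖F (a', b')‖ < ‖F (a, b)‖ :=
      (ContinuousMap.norm_lt_iff _ hM).2 fun p => hlt p p.2
    have h2 := Metric.infDist_le_dist_of_mem (x := (0 : V))
      (show F.rangeRestrict.toAffineMap (a', b') ∈ (s' : Set V) from ⟨_, (hs _).2 ha', rfl⟩)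
    rw [hmin, dist_zero_left, dist_zero_left] at h2
    exact absurd h1 (not_lt.2 h2)

theorem exists_equioscillating_slab {X : Set E} (hX : IsCompact X) {v : E} (hv : v ≠ 0)
    (π : E →L[ℝ] W) (hπ : π v = 0) :
    ∃ (a : E →L[ℝ] ℝ) (b M : ℝ), a v = 1 ∧ 0 ≤ M ∧ (∀ p ∈ X, |a p + b| ≤ M) ∧
      (0 < M → (0 : W × ℝ) ∈ convexHull ℝ
        ((fun p => (π p, (1 : ℝ))) '' {p ∈ X | a p + b = M} ∪
          (fun p => (-π p, (-1 : ℝ))) '' {p ∈ X | a p + b = -M})) := by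
  obtain ⟨a, b, M, hav, hM, hle, hmin⟩ := exists_minimal_slab hX hv
  refine ⟨a, b, M, hav, hM, hle, fun hM0 => ?_⟩
  by_contra h0
  have hZ : ∀ c : ℝ, IsCompact {p ∈ X | a p + b = c} := fun c =>
    hX.inter_right (isClosed_eq (by fun_prop) continuous_const)
  have hconv := (((hZ M).image (f := fun p => (π p, (1 : ℝ))) (by fun_prop)).union
    ((hZ (-M)).image (f := fun p => (-π p, (-1 : ℝ))) (by fun_prop)))
    |>.convexHull_of_finiteDimensional
  obtain ⟨h, u, hu0, hu⟩ := geometric_hahn_banach_point_closed (convex_convexHull ℝ _)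
    hconv.isClosed h0
  rw [map_zero] at hu0
  let k : E → ℝ := fun p => h (π p, 1)
  have hkc : Continuous k := by fun_prop
  have hkpos : ∀ p ∈ X, a p + b = M → 0 < k p := fun p hp hpM =>
    hu0.trans (hu _ (subset_convexHull ℝ _ (Or.inl ⟨p, ⟨hp, hpM⟩, rfl⟩)))
  have hkneg : ∀ p ∈ X, a p + b = -M → k p < 0 := fun p hp hpM => by
    have := hu0.trans (hu _ (subset_convexHull ℝ _ (Or.inr ⟨p, ⟨hp, hpM⟩, rfl⟩)))
    have hneg : ((-π p, (-1 : ℝ)) : W × ℝ) = -(π p, 1) := by simp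
    beta_reduce at this
    rw [hneg, map_neg] at this
    simp only [k]; linarith
  have hev : ∀ᶠ e in 𝓝 (0 : ℝ), ∀ p ∈ X,
      (0 < e → |a p + b| ≤ M → |a p + b - e * k p| < M) := by
    refine hX.eventually_forall_of_forall_eventually fun p hp => ?_
    have c1 : Continuous fun z : ℝ × E => a z.2 + b - z.1 * k z.2 := by fun_prop
    have c2 : Continuous fun z : ℝ × E => k z.2 := by fun_prop
    have hb := abs_le.1 (hle p hp)
    have lt_const : ∀ f : ℝ × E → ℝ, Continuous f → ∀ c, f (0, p) < c →
        ∀ᶠ z in 𝓝 ((0 : ℝ), p), f z < c := fun f hf c h => (hf.tendsto _).eventually_lt_const h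
    have const_lt : ∀ f : ℝ × E → ℝ, Continuous f → ∀ c, c < f (0, p) →
        ∀ᶠ z in 𝓝 ((0 : ℝ), p), c < f z := fun f hf c h => (hf.tendsto _).eventually_const_lt h
    rcases hb.2.lt_or_eq with hlt | heq
    · rcases hb.1.lt_or_eq with hlt' | heq'
      · filter_upwards [lt_const _ c1 M (by simpa), const_lt _ c1 (-M) (by simpa using hlt')]
          with z h1 h2 _ _ using abs_lt.2 ⟨h2, h1⟩
      · filter_upwards [lt_const _ c1 M (by simpa), lt_const _ c2 0 (hkneg p hp heq'.symm)]
          with z h1 h2 hz hz2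
        have := abs_le.1 hz2
        exact abs_lt.2 ⟨by nlinarith, h1⟩
    · filter_upwards [const_lt _ c1 (-M) (by simp; linarith), const_lt _ c2 0 (hkpos p hp heq)]
        with z h1 h2 hz hz2
      have := abs_le.1 hz2
      exact abs_lt.2 ⟨h1, by nlinarith⟩
  obtain ⟨e, he, he0⟩ := ((hev.filter_mono nhdsWithin_le_nhds).and
    (self_mem_nhdsWithin : Ioi (0 : ℝ) ∈ 𝓝[>] 0)).exists
  obtain ⟨p, hp, hpM⟩ := hmin (a - e • (h.comp (ContinuousLinearMap.inl ℝ W ℝ)).comp π)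
    (b - e * h (0, 1)) (by simp [hav, hπ, ← Prod.zero_eq_mk]) hM0
  refine absurd hpM (not_le.2 ?_)
  have hk : k p = h (π p, 0) + h (0, 1) := by
    rw [← map_add]; simp [k]
  have hp' := he p hp he0 (hle p hp)
  rw [hk] at hp'
  have heq : (a - e • (h.comp (ContinuousLinearMap.inl ℝ W ℝ)).comp π) p + (b - e * h (0, 1)) =
      a p + b - e * (h (π p, 0) + h (0, 1)) := by
    simp
    ring
  rwa [heq]
end Minimax

section Midpoints

theorem exists_fiber_center {E : Type*} [NormedAddCommGroup E] [NormedSpace ℝ E] {K : Set E}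
    (hK : IsCompact K) (hKc : Convex ℝ K) {v : E} (hv : v ≠ 0) {k : E} (hk : k ∈ K) :
    ∃ c h : ℝ, 0 ≤ h ∧ ∀ s : ℝ, k + (c + s) • v ∈ K ↔ |s| ≤ h := by
  let S : Set ℝ := (fun s : ℝ => k + s • v) ⁻¹' K
  have hS : IsCompact S :=
    ((Homeomorph.addLeft k).isClosedEmbedding.comp
      (isClosedEmbedding_smul_left (𝕜 := ℝ) hv)).isCompact_preimage hK
  have hSc : Convex ℝ S := by
    intro s hs t ht x y hx hy hxy
    have := hKc hs ht hx hy hxy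
    change k + (x • s + y • t) • v ∈ K
    convert this using 1
    obtain rfl : x = 1 - y := by linarith
    simp only [smul_eq_mul]
    module
  have hSn : S.Nonempty := ⟨0, by simpa [S] using hk⟩
  have hI := eq_Icc_of_connected_compact ⟨hSn, hSc.isPreconnected⟩ hS
  have hle : sInf S ≤ sSup S := by
    obtain ⟨s, hs⟩ := hSn
    rw [hI] at hs
    exact hs.1.trans hs.2
  refine ⟨(sInf S + sSup S) / 2, (sSup S - sInf S) / 2, by linarith, fun s => ?_⟩
  change (sInf S + sSup S) / 2 + s ∈ S ↔ _
  generalize sInf S = x at *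
  generalize sSup S = y at *
  rw [hI, mem_Icc, abs_le]
  constructor <;> rintro ⟨h1, h2⟩ <;> constructor <;> linarith

variable {E W : Type*} [NormedAddCommGroup E] [NormedSpace ℝ E]
  [NormedAddCommGroup W] [NormedSpace ℝ W]

/-- The fibre of `π` over a point `x` of `π '' K` is the segment in direction `v` with midpoint
`m x` and half-length `h x`. -/
structure IsFiberMidpoint (K : Set E) (π : E →L[ℝ] W) (v : E) (m : W → E) (h : W → ℝ) : Prop where
  map_mid : ∀ x ∈ π '' K, π (m x) = x
  nonneg : ∀ x ∈ π '' K, 0 ≤ h x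
  mem_iff : ∀ x ∈ π '' K, ∀ s : ℝ, m x + s • v ∈ K ↔ |s| ≤ h x

/-- For every line in `W`, the part of `K` above that line is centrally symmetric. -/
def HasSymmetricSections (K : Set E) (π : E →L[ℝ] W) : Prop :=
  ∀ z d : W, d ≠ 0 → ∃ c : E, ∀ k ∈ K, (∃ t : ℝ, π k = z + t • d) →
    (2 : ℝ) • c - k ∈ K ∧ ∃ t : ℝ, π ((2 : ℝ) • c - k) = z + t • d

variable {K : Set E} {π : E →L[ℝ] W} {v : E} {m : W → E} {h : W → ℝ}

theorem exists_isFiberMidpoint (hK : IsCompact K) (hKc : Convex ℝ K) (hv : v ≠ 0)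
    (hπ : π v = 0) : ∃ m h, IsFiberMidpoint K π v m h := by
  have key : ∀ x : W, ∃ (m : E) (h : ℝ), x ∈ π '' K →
      π m = x ∧ 0 ≤ h ∧ ∀ s : ℝ, m + s • v ∈ K ↔ |s| ≤ h := by
    intro x
    by_cases hx : x ∈ π '' K
    · obtain ⟨k, hk, rfl⟩ := hx
      obtain ⟨c, h, hh, hs⟩ := exists_fiber_center hK hKc hv hk
      refine ⟨k + c • v, h, fun _ => ⟨by simp [hπ], hh, fun s => ?_⟩⟩
      rw [← hs, add_smul, add_assoc]
    · exact ⟨0, 0, fun h => absurd h hx⟩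
  choose m h hmh using key
  exact ⟨m, h, fun x hx => (hmh x hx).1, fun x hx => (hmh x hx).2.1,
    fun x hx => (hmh x hx).2.2⟩

namespace IsFiberMidpoint

theorem mid_mem (hm : IsFiberMidpoint K π v m h) {x : W} (hx : x ∈ π '' K) : m x ∈ K := by
  simpa using (hm.mem_iff x hx 0).2 (by simpa using hm.nonneg x hx)

theorem exists_eq (hm : IsFiberMidpoint K π v m h) (hker : ∀ x, π x = 0 → ∃ s : ℝ, x = s • v)
    {p : E} (hp : π p ∈ π '' K) : ∃ s : ℝ, p = m (π p) + s • v := by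
  obtain ⟨s, hs⟩ := hker (p - m (π p)) (by rw [map_sub, hm.map_mid _ hp, sub_self])
  exact ⟨s, by rw [← hs]; abel⟩

/-- Along a maximal chord, the half-lengths of the fibres are symmetric about the midpoint of the
chord, and so are the midpoints of the fibres. -/
theorem reflect_chord (hm : IsFiberMidpoint K π v m h) (hsec : HasSymmetricSections K π)
    (hπ : π v = 0) (hker : ∀ x, π x = 0 → ∃ s : ℝ, x = s • v) {p q : W} (hpq : p ≠ q)
    (hmax : IsMaximalChord (π '' K) p q) {x y : W} (hx : x ∈ π '' K)
    (hxl : ∃ t : ℝ, x = p + t • (q - p)) (hxy : x + y = p + q) :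
    h x = h y ∧ m x + m y = m p + m q := by
  obtain ⟨hp, hq, hmax⟩ := hmax
  have hd : q - p ≠ 0 := sub_ne_zero.2 hpq.symm
  obtain ⟨c, hc⟩ := hsec p (q - p) hd
  have hcsum : (2 : ℝ) • π c = p + q := by
    obtain ⟨hp1, s, hs⟩ := hc (m p) (hm.mid_mem hp) ⟨0, by simp [hm.map_mid p hp]⟩
    obtain ⟨hq1, s', hs'⟩ := hc (m q) (hm.mid_mem hq) ⟨1, by simp [hm.map_mid q hq]⟩
    have h1 := hmax s (by rw [← hs]; exact mem_image_of_mem _ hp1)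
    have h2 := hmax s' (by rw [← hs']; exact mem_image_of_mem _ hq1)
    rw [map_sub, map_smul, hm.map_mid p hp] at hs
    rw [map_sub, map_smul, hm.map_mid q hq] at hs'
    have h3 : (s - s' - 1) • (q - p) = 0 := by
      have : (s - s' - 1) • (q - p) = (p + s • (q - p)) - (p + s' • (q - p)) - (q - p) := by
        module
      rw [this, ← hs, ← hs']
      abel
    rcases smul_eq_zero.1 h3 with h3 | h3
    · obtain rfl : s = 1 := by linarith [h1.2, h2.1]
      rw [one_smul] at hs
      rw [eq_add_of_sub_eq hs]; abel
    · exact absurd h3 hd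
  have main : ∀ x y : W, x ∈ π '' K → (∃ t : ℝ, x = p + t • (q - p)) → x + y = p + q →
      h x = h y ∧ m x + m y = (2 : ℝ) • c := by
    intro x y hx hxl hxy
    obtain ⟨t, ht⟩ := hxl
    have hyt : y = p + (1 - t) • (q - p) := by
      rw [eq_sub_of_add_eq' hxy, ht]; module
    have hy : y ∈ π '' K := by
      refine ⟨_, (hc (m x) (hm.mid_mem hx) ⟨t, by rw [hm.map_mid x hx, ht]⟩).1, ?_⟩
      rw [map_sub, map_smul, hcsum, hm.map_mid x hx, ← hxy]; abel
    obtain ⟨d, hd⟩ := hker ((2 : ℝ) • c - m x - m y) (by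
      rw [map_sub, map_sub, map_smul, hcsum, hm.map_mid x hx, hm.map_mid y hy, ← hxy]; abel)
    have f1 : ∀ s : ℝ, |s| ≤ h x → |d - s| ≤ h y := by
      intro s hs
      have := (hc _ ((hm.mem_iff x hx s).2 hs) ⟨t, by
        rw [map_add, map_smul, hπ, smul_zero, add_zero, hm.map_mid x hx, ht]⟩).1
      rw [← hm.mem_iff y hy]
      convert this using 1
      rw [sub_smul, ← hd]; abel
    have f2 : ∀ s : ℝ, |s| ≤ h y → |d - s| ≤ h x := by
      intro s hs
      have := (hc _ ((hm.mem_iff y hy s).2 hs) ⟨1 - t, by simp [hπ, hm.map_mid y hy, ← hyt]⟩).1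
      rw [← hm.mem_iff x hx]
      convert this using 1
      rw [sub_smul, ← hd]; abel
    have n1 := hm.nonneg x hx
    have n2 := hm.nonneg y hy
    have g1 := abs_le.1 (f1 (h x) (abs_of_nonneg n1).le)
    have g2 := abs_le.1 (f1 (-h x) (by rw [abs_neg, abs_of_nonneg n1]))
    have g3 := abs_le.1 (f2 (h y) (abs_of_nonneg n2).le)
    have g4 := abs_le.1 (f2 (-h y) (by rw [abs_neg, abs_of_nonneg n2]))
    obtain rfl : d = 0 := by linarith
    refine ⟨by linarith, ?_⟩
    rw [zero_smul, sub_sub, sub_eq_zero] at hd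
    exact hd.symm
  refine ⟨(main x y hx hxl hxy).1, ?_⟩
  rw [(main x y hx hxl hxy).2, (main p q hp ⟨0, by simp⟩ rfl).2]

theorem halfLength_eq_of_maximal (hm : IsFiberMidpoint K π v m h)
    (hsec : HasSymmetricSections K π) (hπ : π v = 0) (hker : ∀ x, π x = 0 → ∃ s : ℝ, x = s • v)
    {p q : W} (hmax : IsMaximalChord (π '' K) p q) : h p = h q := by
  rcases eq_or_ne p q with rfl | hpq
  · rfl
  · exact (hm.reflect_chord hsec hπ hker hpq hmax hmax.1 ⟨0, by simp⟩ rfl).1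

theorem halfLength_eq_of_extends (hm : IsFiberMidpoint K π v m h)
    (hsec : HasSymmetricSections K π) (hπ : π v = 0) (hker : ∀ x, π x = 0 → ∃ s : ℝ, x = s • v)
    (hc : Convex ℝ (π '' K)) (hcp : IsCompact (π '' K)) (hint : (interior (π '' K)).Nonempty)
    {p q : W} (hp : p ∈ frontier (π '' K)) (hq : q ∈ frontier (π '' K)) {t : ℝ} (ht : 1 < t)
    (hy : p + t • (q - p) ∈ π '' K) : h p = h q := by
  obtain ⟨o, ho⟩ := hint
  have hop : o ≠ p := by rintro rfl; exact hp.2 ho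
  obtain ⟨r, hr, l, hl0, hl1, hol⟩ := exists_frontier_beyond hcp.isBounded ho hop
  have hpr := isMaximalChord_of_interior hc hcp.isClosed hp hr hl0 hl1 (hol ▸ ho)
  have hqr : IsMaximalChord (π '' K) q r := by
    refine isMaximalChord_of_interior hc hcp.isClosed hq hr hl0 hl1 ?_
    have h1 : (1 - l) • (p + t • (q - p)) + l • r ∈ π '' K :=
      hc hy hpr.2.1 (by linarith) hl0.le (by ring)
    have h2 := hc.combo_interior_self_mem_interior ho h1 (a := 1 - t⁻¹) (b := t⁻¹)
      (by linarith [inv_lt_one_of_one_lt₀ ht]) (by positivity) (by ring)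
    convert h2 using 1
    have : t ≠ 0 := by linarith
    rw [hol]
    match_scalars <;> field_simp <;> ring
  rw [hm.halfLength_eq_of_maximal hsec hπ hker hpr,
    hm.halfLength_eq_of_maximal hsec hπ hker hqr]

theorem halfLength_eq_of_frontier (hm : IsFiberMidpoint K π v m h)
    (hsec : HasSymmetricSections K π) (hπ : π v = 0) (hker : ∀ x, π x = 0 → ∃ s : ℝ, x = s • v)
    (hc : Convex ℝ (π '' K)) (hcp : IsCompact (π '' K)) (hint : (interior (π '' K)).Nonempty)
    {p q : W} (hp : p ∈ frontier (π '' K)) (hq : q ∈ frontier (π '' K)) : h p = h q := by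
  by_cases h1 : ∃ t : ℝ, 1 < t ∧ p + t • (q - p) ∈ π '' K
  · obtain ⟨t, ht, hy⟩ := h1
    exact hm.halfLength_eq_of_extends hsec hπ hker hc hcp hint hp hq ht hy
  by_cases h2 : ∃ t : ℝ, t < 0 ∧ p + t • (q - p) ∈ π '' K
  · obtain ⟨t, ht, hy⟩ := h2
    refine (hm.halfLength_eq_of_extends hsec hπ hker hc hcp hint hq hp (t := 1 - t)
      (by linarith) ?_).symm
    convert hy using 1
    module
  push Not at h1 h2
  exact hm.halfLength_eq_of_maximal hsec hπ hker ⟨hcp.isClosed.frontier_subset hp,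
    hcp.isClosed.frontier_subset hq, fun t ht =>
      ⟨not_lt.1 fun h => h2 t h ht, not_lt.1 fun h => h1 t h ht⟩⟩

end IsFiberMidpoint

end Midpoints

section Reflection
variable {E W : Type*} [NormedAddCommGroup E] [NormedSpace ℝ E] [FiniteDimensional ℝ E]
  [NormedAddCommGroup W] [NormedSpace ℝ W]

/-- If the origin is a convex combination of at most four points `σ i • (x i, 1)` with signs
`σ i`, then convex combinations of the points with positive and with negative sign agree, and one
of the two families is a single point or both are pairs. -/
theorem exists_crossing {W ι : Type*} [NormedAddCommGroup W] [NormedSpace ℝ W] [Fintype ι]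
    {σ w : ι → ℝ} {x : ι → W} (hcard : Fintype.card ι ≤ 4) (hσ : ∀ i, σ i = 1 ∨ σ i = -1)
    (hw : ∀ i, 0 < w i) (hw1 : ∑ i, w i = 1) (hwσ : ∑ i, w i * σ i = 0)
    (hwx : ∑ i, w i • σ i • x i = 0) :
    ∃ (I J : Finset ι) (u : ι → ℝ), (∀ i, 0 < u i) ∧ (∀ i ∈ I, σ i = 1) ∧ (∀ i ∈ J, σ i = -1) ∧
      ∑ i ∈ I, u i = 1 ∧ ∑ i ∈ J, u i = 1 ∧ ∑ i ∈ I, u i • x i = ∑ i ∈ J, u i • x i ∧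
      (I.card = 1 ∨ J.card = 1 ∨ I.card = 2 ∧ J.card = 2) := by
  classical
  let I := Finset.univ.filter fun i => σ i = 1
  let J := Finset.univ.filter fun i => ¬ σ i = 1
  have hI : ∀ i ∈ I, σ i = 1 := fun i hi => by simpa [I] using hi
  have hJ : ∀ i ∈ J, σ i = -1 := fun i hi => (hσ i).resolve_left (by simpa [J] using hi)
  have s1 : ∑ i ∈ I, w i + ∑ i ∈ J, w i = 1 := by
    rw [← hw1]; exact Finset.sum_filter_add_sum_filter_not _ _ _
  have s2 : ∑ i ∈ I, w i - ∑ i ∈ J, w i = 0 := by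
    rw [← hwσ, ← Finset.sum_filter_add_sum_filter_not Finset.univ (fun i => σ i = 1),
      sub_eq_add_neg, ← Finset.sum_neg_distrib]
    congr 1
    · exact Finset.sum_congr rfl fun i hi => by simp [hI i hi]
    · exact Finset.sum_congr rfl fun i hi => by simp [hJ i hi]
  have s3 : ∑ i ∈ I, w i • x i - ∑ i ∈ J, w i • x i = 0 := by
    rw [← hwx, ← Finset.sum_filter_add_sum_filter_not Finset.univ (fun i => σ i = 1),
      sub_eq_add_neg, ← Finset.sum_neg_distrib]
    congr 1
    · exact Finset.sum_congr rfl fun i hi => by simp [hI i hi]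
    · exact Finset.sum_congr rfl fun i hi => by simp [hJ i hi]
  have hcard' : I.card + J.card ≤ 4 := by
    have h : I.card + J.card = Fintype.card ι :=
      Finset.card_filter_add_card_filter_not (s := Finset.univ) fun i => σ i = 1
    omega
  have hI0 : I.card ≠ 0 := by
    intro h
    rw [Finset.card_eq_zero] at h
    rw [h, Finset.sum_empty] at s1 s2
    linarith
  have hJ0 : J.card ≠ 0 := by
    intro h
    rw [Finset.card_eq_zero] at h
    rw [h, Finset.sum_empty] at s1 s2
    linarith
  refine ⟨I, J, fun i => 2 * w i, fun i => by linarith [hw i], hI, hJ, ?_, ?_, ?_, by omega⟩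
  · rw [← Finset.mul_sum]; linarith
  · rw [← Finset.mul_sum]; linarith
  · simp only [mul_smul, ← Finset.smul_sum]
    rw [sub_eq_zero.1 s3]

/-- A convex body all of whose sections above lines are symmetric has an affine reflection in
the direction of the fibres. -/
theorem exists_affine_reflection (hW : Module.finrank ℝ W = 2) {K : Set E} {π : E →L[ℝ] W} {v : E}
    (hK : IsCompact K) (hKc : Convex ℝ K) (hint : (interior K).Nonempty) (hv : v ≠ 0)
    (hπ : π v = 0) (hker : ∀ x, π x = 0 → ∃ s : ℝ, x = s • v) (hsurj : Function.Surjective π)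
    (hsec : HasSymmetricSections K π) :
    ∃ (a : E →L[ℝ] ℝ) (b : ℝ), a v = 1 ∧ ∀ k ∈ K, k - (2 * (a k + b)) • v ∈ K := by
  have : FiniteDimensional ℝ W := Module.finite_of_finrank_pos (by omega)
  obtain ⟨m, h, hm⟩ := exists_isFiberMidpoint hK hKc hv hπ
  set P := π '' K with hP
  have hPc : Convex ℝ P := hKc.linear_image π.toLinearMap
  have hPk : IsCompact P := hK.image π.continuous
  have hPi : (interior P).Nonempty := by
    obtain ⟨x, hx⟩ := hint
    exact ⟨π x, (π.isOpenMap hsurj).image_interior_subset K ⟨x, hx, rfl⟩⟩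
  have hΓP : frontier P ⊆ P := hPk.isClosed.frontier_subset
  obtain ⟨l, hl⟩ : ∃ l, ∀ x ∈ frontier P, h x = l := by
    obtain ⟨z, hz⟩ := hPi
    obtain ⟨x, hx, -⟩ := exists_frontier_midpoint hW hPc hPk.isBounded hz
    exact ⟨h x, fun y hy =>
      hm.halfLength_eq_of_frontier hsec hπ hker hPc hPk ⟨z, hz⟩ hy hx⟩
  let N : Set E := {p | p + l • v ∈ K ∧ p - l • v ∈ K}
  have hNc : Convex ℝ N := by
    intro p hp q hq s t hs ht hst
    obtain rfl : s = 1 - t := by linarith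
    constructor
    · convert hKc hp.1 hq.1 hs ht hst using 1
      module
    · convert hKc hp.2 hq.2 hs ht hst using 1
      module
  have hNP : ∀ p ∈ N, π p ∈ P := fun p hp => ⟨_, hp.1, by simp [hπ]⟩
  have hNΓ : ∀ p ∈ N, π p ∈ frontier P → p = m (π p) := by
    intro p hp hpΓ
    obtain ⟨s, hs⟩ := hm.exists_eq hker (hNP p hp)
    have h1 := hp.1
    have h2 := hp.2
    rw [hs, add_assoc, ← add_smul, hm.mem_iff _ (hNP p hp), hl _ hpΓ] at h1
    rw [hs, add_sub_assoc, ← sub_smul, hm.mem_iff _ (hNP p hp), hl _ hpΓ] at h2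
    obtain rfl : s = 0 := by linarith [(abs_le.1 h1).2, (abs_le.1 h2).1]
    simpa using hs
  let X : Set E := N ∩ π ⁻¹' frontier P
  have hX : IsCompact X := by
    have h1 : IsCompact {p : E | p + l • v ∈ K} :=
      (Homeomorph.addRight (l • v)).isCompact_preimage.2 hK
    have h2 : IsClosed {p : E | p - l • v ∈ K} := hK.isClosed.preimage (by fun_prop)
    exact (h1.inter_right h2).inter_right (isClosed_frontier.preimage π.continuous)
  have hmX : ∀ x ∈ frontier P, m x ∈ X := by
    intro x hx
    have h0 : 0 ≤ l := hl x hx ▸ hm.nonneg x (hΓP hx)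
    refine ⟨⟨?_, ?_⟩, ?_⟩
    · rw [hm.mem_iff x (hΓP hx), hl x hx, abs_of_nonneg h0]
    · rw [sub_eq_add_neg, ← neg_smul, hm.mem_iff x (hΓP hx), hl x hx, abs_neg, abs_of_nonneg h0]
    · rw [mem_preimage, hm.map_mid x (hΓP hx)]
      exact hx
  obtain ⟨a, b, M, hav, hM, hle, hosc⟩ := exists_equioscillating_slab hX hv π hπ
  have hbound : ∀ z ∈ P, |a (m z) + b| ≤ M := by
    intro z hz
    by_cases hzi : z ∈ interior P
    · obtain ⟨x, hx, y, hy, hxy⟩ := exists_frontier_midpoint hW hPc hPk.isBounded hzi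
      have hzx : z = x + (1 / 2 : ℝ) • (y - x) := by
        have : z = (1 / 2 : ℝ) • (x + y) := by rw [hxy]; module
        rw [this]; module
      have hmax := isMaximalChord_of_interior (l := 1 / 2) hPc hPk.isClosed hx hy (by norm_num)
        (by norm_num) (hzx ▸ hzi)
      have hne : x ≠ y := by
        rintro rfl
        rw [sub_self, smul_zero, add_zero] at hzx
        exact hx.2 (hzx ▸ hzi)
      have h1 := (hm.reflect_chord hsec hπ hker hne hmax hz ⟨_, hzx⟩
        (y := z) (by rw [hxy, two_smul])).2
      have h2 := congrArg a h1
      rw [map_add, map_add] at h2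
      have h3 := abs_le.1 (hle _ (hmX x hx))
      have h4 := abs_le.1 (hle _ (hmX y hy))
      exact abs_le.2 ⟨by linarith, by linarith⟩
    · exact hle _ (hmX z ⟨subset_closure hz, hzi⟩)
  -- on the frontier, a level set of the affine functional is closed under convex combinations
  have hcomb : ∀ {ι : Type _} (J : Finset ι) (u : ι → ℝ) (p : ι → E) (c : ℝ), (∀ i, 0 < u i) →
      (∀ i ∈ J, p i ∈ X) → (∀ i ∈ J, a (p i) + b = c) → ∑ i ∈ J, u i = 1 →
      ∑ i ∈ J, u i • π (p i) ∈ frontier P → a (m (∑ i ∈ J, u i • π (p i))) + b = c := by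
    intro ι J u p c hu hpX hpc hu1 hfr
    have hq : ∑ i ∈ J, u i • p i ∈ N :=
      hNc.sum_mem (fun i _ => (hu i).le) hu1 fun i hi => (hpX i hi).1
    have hπq : π (∑ i ∈ J, u i • p i) = ∑ i ∈ J, u i • π (p i) := by simp
    rw [← hπq, ← hNΓ _ hq (hπq ▸ hfr), map_sum]
    calc ∑ i ∈ J, a (u i • p i) + b = ∑ i ∈ J, (u i * (a (p i) + b)) := by
          simp only [mul_add, Finset.sum_add_distrib, ← Finset.sum_mul, hu1, map_smul, smul_eq_mul,
            one_mul]
      _ = ∑ i ∈ J, u i * c := Finset.sum_congr rfl fun i hi => by rw [hpc i hi]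
      _ = c := by rw [← Finset.sum_mul, hu1, one_mul]
  -- an extreme level set contains the chords between its points
  have hseg : ∀ {ι : Type _} (J : Finset ι) (u : ι → ℝ) (p : ι → E) (c : ℝ), (c = M ∨ c = -M) →
      (∀ i, 0 < u i) → (∀ i ∈ J, p i ∈ X) → (∀ i ∈ J, a (p i) + b = c) → ∑ i ∈ J, u i = 1 →
      J.card = 2 → a (m (∑ i ∈ J, u i • π (p i))) + b = c := by
    classical
    intro ι J u p c hc hu hpX hpc hu1 hJ
    by_cases hfr : ∑ i ∈ J, u i • π (p i) ∈ frontier P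
    · exact hcomb J u p c hu hpX hpc hu1 hfr
    obtain ⟨i, j, hij, rfl⟩ := Finset.card_eq_two.1 hJ
    rw [Finset.sum_pair hij] at hfr hu1 ⊢
    have hi := hpX i (by simp)
    have hj := hpX j (by simp)
    have hin : u i • π (p i) + u j • π (p j) ∈ P :=
      hPc (hΓP hi.2) (hΓP hj.2) (hu i).le (hu j).le hu1
    have hint : u i • π (p i) + u j • π (p j) ∈ interior P :=
      by_contra fun h => hfr ⟨subset_closure hin, h⟩
    have heq : u i • π (p i) + u j • π (p j) = π (p i) + u j • (π (p j) - π (p i)) := by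
      obtain h : u i = 1 - u j := by linarith
      rw [h]; module
    have hmax := isMaximalChord_of_interior hPc hPk.isClosed hi.2 hj.2 (hu j)
      (by linarith [hu i]) (heq ▸ hint)
    have hne : π (p i) ≠ π (p j) := by
      intro h
      rw [h, ← add_smul, hu1, one_smul] at hint
      exact hj.2.2 hint
    have hsum : (u i • π (p i) + u j • π (p j)) + (u j • π (p i) + u i • π (p j)) =
        π (p i) + π (p j) := by
      obtain h : u i = 1 - u j := by linarith
      rw [h]; module
    have h1 := congrArg a (hm.reflect_chord hsec hπ hker hne hmax hin ⟨_, heq⟩ hsum).2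
    rw [← hNΓ _ hi.1 hi.2, ← hNΓ _ hj.1 hj.2, map_add, map_add] at h1
    have h2 := abs_le.1 (hbound _ hin)
    have h3 := abs_le.1 (hbound (u j • π (p i) + u i • π (p j))
      (hPc (hΓP hi.2) (hΓP hj.2) (hu j).le (hu i).le (by linarith)))
    have h4 := hpc i (by simp)
    have h5 := hpc j (by simp)
    rcases hc with rfl | rfl <;> linarith
  have hM0 : M = 0 := by
    by_contra hM0
    obtain ⟨ι, _, z, w, hz, hind, hw, hw1, hwz⟩ := eq_pos_convex_span_of_mem_convexHull
      (hosc (lt_of_le_of_ne hM (Ne.symm hM0)))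
    have hz' : ∀ i, ∃ (p : E) (σ : ℝ), p ∈ X ∧ (σ = 1 ∨ σ = -1) ∧ a p + b = σ * M ∧
        z i = (σ • π p, σ) := by
      intro i
      rcases hz ⟨i, rfl⟩ with ⟨p, ⟨hp, hpM⟩, hzp⟩ | ⟨p, ⟨hp, hpM⟩, hzp⟩
      · exact ⟨p, 1, hp, Or.inl rfl, by rw [hpM, one_mul], by rw [← hzp, one_smul]⟩
      · exact ⟨p, -1, hp, Or.inr rfl, by rw [hpM, neg_one_mul], by rw [← hzp, neg_one_smul]⟩
    choose p σ hpX hσ hpM hzp using hz'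
    have hcard : Fintype.card ι ≤ 4 := by
      have h1 := hind.card_le_finrank_succ
      have h2 := Submodule.finrank_le (vectorSpan ℝ (Set.range z))
      rw [Module.finrank_prod, hW, Module.finrank_self] at h2
      omega
    simp only [hzp] at hwz
    have hwσ : ∑ i, w i * σ i = 0 := by simpa [Prod.snd_sum] using congrArg Prod.snd hwz
    have hwx : ∑ i, w i • σ i • π (p i) = 0 := by simpa [Prod.fst_sum] using congrArg Prod.fst hwz
    obtain ⟨I, J, u, hu, hI, hJ, hIu, hJu, hIJ, hcases⟩ :=
      exists_crossing hcard hσ hw hw1 hwσ hwx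
    have hIM : ∀ i ∈ I, a (p i) + b = M := fun i hi => by rw [hpM, hI i hi, one_mul]
    have hJM : ∀ i ∈ J, a (p i) + b = -M := fun i hi => by rw [hpM, hJ i hi, neg_one_mul]
    have hone : ∀ I : Finset ι, I.card = 1 → ∑ i ∈ I, u i = 1 →
        ∑ i ∈ I, u i • π (p i) ∈ frontier P := by
      intro I hI hIu
      obtain ⟨i, rfl⟩ := Finset.card_eq_one.1 hI
      rw [Finset.sum_singleton] at hIu ⊢
      rw [hIu, one_smul]
      exact (hpX i).2
    have hfin : a (m (∑ i ∈ I, u i • π (p i))) + b = M ∧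
        a (m (∑ i ∈ J, u i • π (p i))) + b = -M := by
      have hI' := hcomb I u p M hu (fun i _ => hpX i) hIM hIu
      have hJ' := hcomb J u p (-M) hu (fun i _ => hpX i) hJM hJu
      rcases hcases with h1 | h1 | ⟨h1, h2⟩
      · have := hone I h1 hIu
        exact ⟨hI' this, hJ' (hIJ ▸ this)⟩
      · have := hone J h1 hJu
        exact ⟨hI' (hIJ ▸ this), hJ' this⟩
      · exact ⟨hseg I u p M (Or.inl rfl) hu (fun i _ => hpX i) hIM hIu h1,
          hseg J u p (-M) (Or.inr rfl) hu (fun i _ => hpX i) hJM hJu h2⟩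
    rw [hIJ] at hfin
    exact hM0 (by linarith [hfin.1, hfin.2])
  refine ⟨a, b, hav, fun k hk => ?_⟩
  have hkP : π k ∈ P := mem_image_of_mem _ hk
  obtain ⟨s, hs⟩ := hm.exists_eq hker hkP
  have h0 : a (m (π k)) + b = 0 := by simpa [hM0] using hbound _ hkP
  have hks : a k + b = s := by
    rw [hs, map_add, map_smul, hav, smul_eq_mul]; linarith
  have hk' : k - (2 * (a k + b)) • v = m (π k) + (-s) • v := by
    rw [hks]
    nth_rewrite 1 [hs]
    module
  rw [hk', hm.mem_iff _ hkP, abs_neg, ← hm.mem_iff _ hkP, ← hs]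
  exact hk

end Reflection

section Inertia
open MeasureTheory Module

variable {E : Type*} [NormedAddCommGroup E] [NormedSpace ℝ E] [FiniteDimensional ℝ E]
  [MeasurableSpace E] [BorelSpace E] {μ : Measure E} [μ.IsAddHaarMeasure]

/-- Integration over a set is invariant under an affine reflection preserving the set. -/
theorem setIntegral_comp_affine_reflection {K : Set E} {a : Dual ℝ E} {b : ℝ} {v : E}
    (hav : a v = 1) (hR : ∀ k ∈ K, k - (2 * (a k + b)) • v ∈ K) (f : E → ℝ) :
    ∫ x in K, f (x - (2 * (a x + b)) • v) ∂μ = ∫ x in K, f x ∂μ := by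
  have ha : Continuous a := a.continuous_of_finiteDimensional
  let R : E → E := fun x => x - (2 * (a x + b)) • v
  have hRc : Continuous R := by fun_prop
  have hRR : Function.Involutive R := by
    intro x
    simp only [R, map_sub, map_smul, hav, smul_eq_mul]
    module
  let L : E →ₗ[ℝ] E := LinearMap.id - (2 : ℝ) • a.smulRight v
  have hLR : ∀ x, R x = L x + (-(2 * b)) • v := by
    intro x
    simp only [R, L, LinearMap.sub_apply, LinearMap.id_apply, LinearMap.smul_apply,
      LinearMap.smulRight_apply]
    module
  have hLL : L * L = 1 := by
    ext x
    simp only [L, Module.End.mul_apply, LinearMap.sub_apply, LinearMap.id_apply,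
      LinearMap.smul_apply, LinearMap.smulRight_apply, map_sub, map_smul, hav,
      Module.End.one_apply]
    module
  have hdet : LinearMap.det L * LinearMap.det L = 1 := by rw [← map_mul, hLL, map_one]
  have habs : |(LinearMap.det L)⁻¹| = 1 := by
    rcases mul_self_eq_one_iff.1 hdet with h | h <;> simp [h]
  have hLm : MeasurePreserving L μ μ := by
    refine ⟨L.continuous_of_finiteDimensional.measurable, ?_⟩
    rw [Measure.map_linearMap_addHaar_eq_smul_addHaar μ (left_ne_zero_of_mul_eq_one hdet), habs]
    simp
  have hRm : MeasurePreserving R μ μ := by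
    rw [show R = (fun x => x + (-(2 * b)) • v) ∘ L from funext hLR]
    exact (measurePreserving_add_right μ _).comp hLm
  let e : E ≃ₜ E := ⟨hRR.toPerm, hRc, hRc⟩
  have hpre : R ⁻¹' K = K := by
    ext x
    exact ⟨fun hx => hRR x ▸ hR _ hx, fun hx => hR x hx⟩
  calc ∫ x in K, f (R x) ∂μ = ∫ x in R ⁻¹' K, f (R x) ∂μ := by rw [hpre]
    _ = ∫ x in K, f x ∂μ := hRm.setIntegral_preimage_emb e.measurableEmbedding f K

/-- The second moment of the functional `u` on a convex body is positive. -/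
theorem setIntegral_sq_pos {K : Set E} (hK : IsCompact K) (hint : (interior K).Nonempty) {g : E}
    {u : Dual ℝ E} (hu : u ≠ 0) : 0 < ∫ x in K, u (x - g) * u (x - g) ∂μ := by
  have hc : Continuous u := u.continuous_of_finiteDimensional
  have hcont : Continuous fun x => u (x - g) * u (x - g) := by fun_prop
  rw [setIntegral_pos_iff_support_of_nonneg_ae (.of_forall fun x => mul_self_nonneg _)
    (hcont.continuousOn.integrableOn_compact hK)]
  have hopen : IsOpen (Function.support (fun x => u (x - g) * u (x - g)) ∩ interior K) :=
    hcont.isOpen_support.inter isOpen_interior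
  refine (hopen.measure_pos μ ?_).trans_le
    (measure_mono (inter_subset_inter_right _ interior_subset))
  obtain ⟨z, hz⟩ := hint
  obtain ⟨w, hw⟩ : ∃ w, u w ≠ 0 := by
    by_contra! h
    exact hu (LinearMap.ext h)
  by_cases hzu : u (z - g) = 0
  · have h1 : Tendsto (fun t : ℝ => z + t • w) (𝓝[>] 0) (𝓝 z) := by
      refine Tendsto.mono_left ?_ nhdsWithin_le_nhds
      exact Continuous.tendsto' (by fun_prop) _ _ (by simp)
    obtain ⟨t, ht, ht0⟩ := ((h1.eventually (isOpen_interior.mem_nhds hz)).and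
      self_mem_nhdsWithin).exists
    refine ⟨z + t • w, ?_, ht⟩
    have : u (z + t • w - g) = t * u w := by
      rw [add_sub_right_comm, map_add, hzu, map_smul, zero_add, smul_eq_mul]
    rw [Function.mem_support, this]
    have := ht0.ne'
    positivity
  · exact ⟨z, mul_ne_zero hzu hzu, hz⟩

/-- A symmetric positive definite bilinear form on a finite dimensional space has an
orthonormal basis. -/
theorem LinearMap.BilinForm.exists_orthonormal_basis {V ι : Type*} [AddCommGroup V] [Module ℝ V]
    [FiniteDimensional ℝ V] [Fintype ι] [DecidableEq ι] (hι : Fintype.card ι = finrank ℝ V)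
    {B : LinearMap.BilinForm ℝ V} (hB : B.IsSymm) (hpos : ∀ u, u ≠ 0 → 0 < B u u) :
    ∃ e : Basis ι ℝ V, ∀ i j, B (e i) (e j) = if i = j then 1 else 0 := by
  obtain ⟨f, hf⟩ :=
    LinearMap.BilinForm.exists_orthogonal_basis (LinearMap.BilinForm.isSymm_iff.1 hB)
  let f' := f.reindex (Fintype.equivFinOfCardEq hι).symm
  have hf0 : ∀ i, 0 < B (f' i) (f' i) := fun i => hpos _ (f'.ne_zero i)
  have hs : ∀ i, IsUnit (√(B (f' i) (f' i)))⁻¹ := fun i =>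
    (inv_ne_zero (Real.sqrt_pos.2 (hf0 i)).ne').isUnit
  refine ⟨f'.isUnitSMul hs, fun i j => ?_⟩
  simp only [Basis.isUnitSMul_apply, map_smul, LinearMap.smul_apply, smul_eq_mul]
  split_ifs with hij
  · subst hij
    have h := Real.mul_self_sqrt (hf0 i).le
    have h' := (Real.sqrt_pos.2 (hf0 i)).ne'
    nth_rewrite 3 [← h]
    field_simp
  · have : B (f' i) (f' j) = 0 := by
      simp only [f', Basis.reindex_apply]
      exact hf fun h => hij (by simpa using h)
    rw [this, mul_zero, mul_zero]

/-- A convex body invariant under all orthogonal reflections is a ball. -/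
theorem exists_eq_closedBall_of_reflection {F : Type*} [NormedAddCommGroup F]
    [InnerProductSpace ℝ F] {K : Set F} (hK : IsCompact K) (hKc : Convex ℝ K) (hKn : K.Nontrivial)
    (hR : ∀ n : F, n ≠ 0 → ∀ x ∈ K, x - (2 * (inner ℝ n x / ‖n‖ ^ 2)) • n ∈ K) :
    ∃ r : ℝ, 0 < r ∧ K = Metric.closedBall 0 r := by
  have hmove : ∀ x ∈ K, ∀ y, ‖x‖ = ‖y‖ → y ∈ K := by
    intro x hx y hxy
    by_cases hne : x = y
    · exact hne ▸ hx
    have h0 : ‖x - y‖ ^ 2 ≠ 0 := by simpa [sub_eq_zero] using hne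
    convert hR (x - y) (sub_ne_zero.2 hne) x hx using 1
    have h1 : 2 * inner ℝ (x - y) x = ‖x - y‖ ^ 2 := by
      rw [norm_sub_sq_real, inner_sub_left, real_inner_self_eq_norm_sq, real_inner_comm, ← hxy]
      ring
    rw [← mul_div_assoc, h1, div_self h0]
    module
  obtain ⟨x₀, hx₀, hmax⟩ := hK.exists_isMaxOn hKn.nonempty continuous_norm.continuousOn
  have hr : 0 < ‖x₀‖ := by
    obtain ⟨x, hx, hx0⟩ := hKn.exists_ne 0
    exact (norm_pos_iff.2 hx0).trans_le (hmax hx)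
  refine ⟨‖x₀‖, hr, Subset.antisymm (fun x hx => by simpa using hmax hx) fun y hy => ?_⟩
  rw [mem_closedBall_zero_iff] at hy
  obtain ⟨p, t, hp, ht0, ht1, rfl⟩ : ∃ (p : F) (t : ℝ), ‖x₀‖ = ‖p‖ ∧ 0 ≤ t ∧ t ≤ 1 ∧ y = t • p := by
    by_cases hy0 : y = 0
    · exact ⟨x₀, 0, rfl, le_rfl, zero_le_one, by simp [hy0]⟩
    · have hy0' := norm_pos_iff.2 hy0
      refine ⟨(‖x₀‖ / ‖y‖) • y, ‖y‖ / ‖x₀‖, ?_, by positivity, (div_le_one hr).2 hy, ?_⟩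
      · rw [norm_smul, norm_div, norm_norm, norm_norm, div_mul_cancel₀ _ hy0'.ne']
      · rw [smul_smul, div_mul_div_cancel₀ hr.ne', div_self hy0'.ne', one_smul]
  have h := hKc (hmove x₀ hx₀ p hp) (hmove x₀ hx₀ (-p) (by rw [norm_neg, hp]))
    (a := (1 + t) / 2) (b := (1 - t) / 2) (by linarith) (by linarith) (by ring)
  convert h using 1
  module

/-- A convex body with an affine reflection in every direction is an ellipsoid. -/
theorem exists_affineEquiv_image_closedBall [Nontrivial E] {ι : Type*} [Fintype ι]
    (hι : Fintype.card ι = finrank ℝ E) {K : Set E} (hK : IsCompact K) (hKc : Convex ℝ K)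
    (hint : (interior K).Nonempty)
    (hR : ∀ v : E, v ≠ 0 → ∃ (a : E →L[ℝ] ℝ) (b : ℝ), a v = 1 ∧
      ∀ k ∈ K, k - (2 * (a k + b)) • v ∈ K) :
    ∃ T : EuclideanSpace ℝ ι ≃ᵃ[ℝ] E, K = T '' Metric.closedBall 0 1 := by
  classical
  let μ : Measure E := Measure.addHaar
  have hcont : ∀ u : Dual ℝ E, Continuous u := fun u => u.continuous_of_finiteDimensional
  have hfin : μ K ≠ ⊤ := hK.measure_lt_top.ne
  have hvol : 0 < μ.real K := ENNReal.toReal_pos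
    ((isOpen_interior.measure_pos μ hint).trans_le (measure_mono interior_subset)).ne' hfin
  let g : E := (μ.real K)⁻¹ • ∫ x in K, x ∂μ
  have hI : ∀ f : E → ℝ, Continuous f → IntegrableOn f K μ := fun f hf =>
    hf.continuousOn.integrableOn_compact hK
  have hg : ∀ u : Dual ℝ E, ∫ x in K, u x ∂μ = μ.real K * u g := by
    intro u
    have h := (LinearMap.toContinuousLinearMap u).integral_comp_comm
      (continuous_id.continuousOn.integrableOn_compact (μ := μ) hK)
    simp only [LinearMap.coe_toContinuousLinearMap', id] at h
    rw [h]
    simp only [g, map_smul, smul_eq_mul]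
    field_simp
  let B : LinearMap.BilinForm ℝ (Dual ℝ E) := LinearMap.mk₂ ℝ
    (fun u w => ∫ x in K, u (x - g) * w (x - g) ∂μ)
    (fun u u' w => by
      rw [← integral_add]
      · simp [add_mul]
      all_goals exact hI _ (by fun_prop (disch := simp [hcont])))
    (fun c u w => by
      rw [smul_eq_mul, ← integral_const_mul]
      simp [mul_assoc])
    (fun u w w' => by
      rw [← integral_add]
      · simp [mul_add]
      all_goals exact hI _ (by fun_prop (disch := simp [hcont])))
    (fun c u w => by
      rw [smul_eq_mul, ← integral_const_mul]
      simp [mul_left_comm])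
  have hBdef : ∀ u w, B u w = ∫ x in K, u (x - g) * w (x - g) ∂μ := fun u w => rfl
  have hBs : B.IsSymm := ⟨fun u w => by simp [hBdef, mul_comm]⟩
  have hBp : ∀ u, u ≠ 0 → 0 < B u u := fun u hu => setIntegral_sq_pos hK hint hu
  obtain ⟨e, he⟩ := LinearMap.BilinForm.exists_orthonormal_basis
    (hι.trans Subspace.dual_finrank_eq.symm) hBs hBp
  let Φ₀ : E →ₗ[ℝ] EuclideanSpace ℝ ι :=
    (WithLp.linearEquiv 2 ℝ (ι → ℝ)).symm.toLinearMap ∘ₗ LinearMap.pi e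
  have hΦ₀ : ∀ x i, Φ₀ x i = e i x := fun x i => rfl
  have hinj : Function.Injective Φ₀ := by
    refine (injective_iff_map_eq_zero _).2 fun x hx => ?_
    refine (forall_dual_apply_eq_zero_iff ℝ x).1 fun u => ?_
    have he0 : ∀ i, e i x = 0 := fun i => by rw [← hΦ₀, hx, PiLp.zero_apply]
    rw [← e.sum_repr u, LinearMap.sum_apply]
    exact Finset.sum_eq_zero fun i _ => by rw [LinearMap.smul_apply, he0, smul_zero]
  let Φ : E ≃ₗ[ℝ] EuclideanSpace ℝ ι := LinearEquiv.ofInjectiveOfFinrankEq Φ₀ hinj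
    (by rw [finrank_euclideanSpace, hι])
  have hΦ : ∀ x i, Φ x i = e i x := fun x i => rfl
  let K' : Set (EuclideanSpace ℝ ι) := (fun x => Φ (x - g)) '' K
  have hΦc : Continuous Φ := Φ.toLinearMap.continuous_of_finiteDimensional
  have hK' : IsCompact K' := hK.image (by fun_prop)
  have hKc' : Convex ℝ K' := by
    rintro _ ⟨x, hx, rfl⟩ _ ⟨y, hy, rfl⟩ s t hs ht hst
    refine ⟨s • x + t • y, hKc hx hy hs ht hst, ?_⟩
    obtain rfl : s = 1 - t := by linarith
    simp only [map_sub, map_add, map_smul]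
    module
  have hKn' : K'.Nontrivial := by
    refine Set.Nontrivial.image ?_ (Φ.injective.comp (sub_left_injective (b := g)))
    by_contra h
    rw [not_nontrivial_iff] at h
    obtain ⟨z, hz⟩ := hint
    rw [h.eq_singleton_of_mem (interior_subset hz), interior_singleton] at hz
    exact hz
  obtain ⟨r, hr, hball⟩ := exists_eq_closedBall_of_reflection hK' hKc' hKn' <| by
    rintro n hn _ ⟨x, hx, rfl⟩
    obtain ⟨v, rfl⟩ := Φ.surjective n
    have hv : v ≠ 0 := by
      rintro rfl
      exact hn (map_zero _)
    obtain ⟨a, b, hav, hab⟩ := hR v hv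
    set a' : Dual ℝ E := a.toLinearMap with ha'
    have haa : ∀ x, a x = a' x := fun x => rfl
    simp only [haa] at hav hab
    have hab0 : a' g + b = 0 := by
      have h1 := setIntegral_comp_affine_reflection (μ := μ) hav hab a'
      simp only [map_sub, map_smul, hav, smul_eq_mul, mul_one] at h1
      rw [integral_sub (hI _ (hcont _)) (hI _ (by fun_prop (disch := simp [hcont]))),
        integral_const_mul, integral_add (hI _ (hcont _)) (hI _ continuous_const), hg,
        setIntegral_const, smul_eq_mul] at h1
      have h2 : μ.real K * (a' g + b) = 0 := by linarith
      exact (mul_eq_zero.1 h2).resolve_left hvol.ne'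
    have hBa : ∀ u : Dual ℝ E, B u a' = u v * B a' a' := by
      intro u
      have h1 := setIntegral_comp_affine_reflection (μ := μ) hav hab
        fun x => u (x - g) * a' (x - g)
      have h2 : ∀ x, u (x - (2 * (a' x + b)) • v - g) * a' (x - (2 * (a' x + b)) • v - g) =
          2 * u v * (a' (x - g) * a' (x - g)) - u (x - g) * a' (x - g) := by
        intro x
        obtain rfl : b = - a' g := by linarith
        simp only [map_sub, map_smul, hav, smul_eq_mul]
        ring
      simp only [h2] at h1
      rw [integral_sub (hI _ (by fun_prop (disch := simp [hcont])))
        (hI _ (by fun_prop (disch := simp [hcont]))), integral_const_mul, ← hBdef, ← hBdef] at h1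
      linarith
    have hrepr : ∀ i, e.repr a' i = B a' a' * Φ v i := by
      intro i
      have h1 := hBa (e i)
      nth_rewrite 1 [← e.sum_repr a'] at h1
      simp only [map_sum, map_smul, he, smul_eq_mul, mul_ite, mul_one, mul_zero,
        Finset.sum_ite_eq, Finset.mem_univ, if_true] at h1
      rw [h1, hΦ, mul_comm]
    have ha_inner : ∀ x, a' x = B a' a' * inner ℝ (Φ v) (Φ x) := by
      intro x
      nth_rewrite 1 [← e.sum_repr a']
      simp only [LinearMap.sum_apply, LinearMap.smul_apply, hrepr, smul_eq_mul, PiLp.inner_apply,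
        Finset.mul_sum, RCLike.inner_apply, conj_trivial, hΦ]
      exact Finset.sum_congr rfl fun i _ => by ring
    have hnorm := ha_inner v
    rw [hav, real_inner_self_eq_norm_sq] at hnorm
    have hn0 : ‖Φ v‖ ^ 2 ≠ 0 := by simpa using hn
    refine ⟨_, hab x hx, ?_⟩
    have h3 : a' x + b = inner ℝ (Φ v) (Φ (x - g)) / ‖Φ v‖ ^ 2 := by
      have : a' x + b = a' (x - g) := by rw [map_sub]; linarith
      rw [this, ha_inner, eq_div_iff hn0, mul_right_comm, ← hnorm, one_mul]
    rw [← h3]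
    simp only [map_sub, map_smul]
    module
  let T : EuclideanSpace ℝ ι ≃ᵃ[ℝ] E :=
    ((LinearEquiv.smulOfNeZero ℝ (EuclideanSpace ℝ ι) r hr.ne').trans Φ.symm).toAffineEquiv.trans
      (AffineEquiv.constVAdd ℝ E g)
  have hT : ∀ y, T y = g + Φ.symm (r • y) := fun y => rfl
  refine ⟨T, Subset.antisymm (fun x hx => ?_) ?_⟩
  · have h1 : Φ (x - g) ∈ K' := ⟨x, hx, rfl⟩
    rw [hball, mem_closedBall_zero_iff] at h1
    refine ⟨r⁻¹ • Φ (x - g), ?_, ?_⟩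
    · rw [mem_closedBall_zero_iff, norm_smul, norm_inv, Real.norm_of_nonneg hr.le,
        inv_mul_le_iff₀ hr]
      linarith
    · rw [hT, smul_inv_smul₀ hr.ne', LinearEquiv.symm_apply_apply, add_sub_cancel]
  · rintro _ ⟨y, hy, rfl⟩
    rw [mem_closedBall_zero_iff] at hy
    have h1 : r • y ∈ K' := by
      rw [hball, mem_closedBall_zero_iff, norm_smul, Real.norm_of_nonneg hr.le]
      nlinarith
    obtain ⟨x, hx, hxy⟩ := h1
    rw [hT, ← hxy, LinearEquiv.symm_apply_apply, add_sub_cancel]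
    exact hx

end Inertia

section Sections
variable {K : Set (EuclideanSpace ℝ (Fin 3))}

/-- Symmetric plane sections, phrased through the projection along a line. -/
theorem hasSymmetricSections_of_planes {W : Type*} [NormedAddCommGroup W] [NormedSpace ℝ W]
    (hW : Module.finrank ℝ W = 2) {π : EuclideanSpace ℝ (Fin 3) →L[ℝ] W}
    (hπ : Function.Surjective π)
    (hsym : ∀ H : AffineSubspace ℝ (EuclideanSpace ℝ (Fin 3)),
      Module.finrank ℝ H.direction = 2 →
      ∃ c, SymmWith ((H : Set (EuclideanSpace ℝ (Fin 3))) ∩ K) c) :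
    HasSymmetricSections K π := by
  intro z d hd
  have : FiniteDimensional ℝ W := Module.finite_of_finrank_pos (by omega)
  obtain ⟨p, rfl⟩ := hπ z
  let D : Submodule ℝ (EuclideanSpace ℝ (Fin 3)) := (ℝ ∙ d).comap π.toLinearMap
  have hmem : ∀ x, x ∈ AffineSubspace.mk' p D ↔ ∃ t : ℝ, π x = π p + t • d := by
    intro x
    rw [AffineSubspace.mem_mk', vsub_eq_sub, Submodule.mem_comap, Submodule.mem_span_singleton]
    refine exists_congr fun t => ?_
    rw [ContinuousLinearMap.coe_coe, map_sub, eq_sub_iff_add_eq', eq_comm]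
  have hD : Module.finrank ℝ D = 2 := by
    have hker : Module.finrank ℝ (LinearMap.ker π.toLinearMap) = 1 := by
      have := LinearMap.finrank_range_add_finrank_ker π.toLinearMap
      rw [LinearMap.range_eq_top.2 hπ, finrank_top, hW, finrank_euclideanSpace_fin] at this
      omega
    let f : D →ₗ[ℝ] W := π.toLinearMap ∘ₗ D.subtype
    have hrange : LinearMap.range f = ℝ ∙ d := by
      rw [LinearMap.range_comp, Submodule.range_subtype]
      exact Submodule.map_comap_eq_of_surjective hπ _
    have hkerf : Module.finrank ℝ (LinearMap.ker f) = 1 := by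
      rw [LinearMap.ker_comp, ← hker]
      exact (Submodule.comapSubtypeEquivOfLe fun x hx => by
        rw [Submodule.mem_comap, LinearMap.mem_ker.1 hx]
        exact zero_mem _).finrank_eq
    rw [← LinearMap.finrank_range_add_finrank_ker f, hrange, finrank_span_singleton hd, hkerf]
  obtain ⟨c, hc⟩ := hsym (AffineSubspace.mk' p D) (by rw [AffineSubspace.direction_mk', hD])
  refine ⟨c, fun k hk hkt => ?_⟩
  have h : (2 : ℝ) • c - k ∈ (AffineSubspace.mk' p D : Set (EuclideanSpace ℝ (Fin 3))) ∩ K := by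
    rw [← hc]
    exact mem_image_of_mem _ ⟨(hmem k).2 hkt, hk⟩
  exact ⟨h.2, (hmem _).1 h.1⟩

end Sections

end AffineReflections

/-- If every plane (2-dimensional affine subspace) of `ℝ³` meets the convex body `K` in a
centrally symmetric section, then `K` is an ellipsoid (affine image of the closed unit ball). -/
theorem ellipsoid_of_all_sections_symmetric
    (K : Set (EuclideanSpace ℝ (Fin 3)))
    (hKcomp : IsCompact K) (hKconv : Convex ℝ K) (hKint : (interior K).Nonempty)
    (hsym : ∀ H : AffineSubspace ℝ (EuclideanSpace ℝ (Fin 3)),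
      Module.finrank ℝ H.direction = 2 →
      ∃ c, SymmWith ((H : Set (EuclideanSpace ℝ (Fin 3))) ∩ K) c) :
    ∃ T : EuclideanSpace ℝ (Fin 3) ≃ᵃ[ℝ] EuclideanSpace ℝ (Fin 3),
      K = T '' Metric.closedBall (0 : EuclideanSpace ℝ (Fin 3)) 1 := by
  refine exists_affineEquiv_image_closedBall (by simp) hKcomp hKconv hKint fun v hv => ?_
  have hfin : Module.finrank ℝ (EuclideanSpace ℝ (Fin 3)) = 2 + 1 := finrank_euclideanSpace_fin
  have : Fact (Module.finrank ℝ (EuclideanSpace ℝ (Fin 3)) = 2 + 1) := ⟨hfin⟩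
  have hW : Module.finrank ℝ (ℝ ∙ v)ᗮ = 2 := Submodule.finrank_orthogonal_span_singleton hv
  have hsurj : Function.Surjective (ℝ ∙ v)ᗮ.orthogonalProjectionOnto := fun w =>
    ⟨w, Submodule.orthogonalProjectionOnto_mem_subspace_eq_self w⟩
  have hker : ∀ x, (ℝ ∙ v)ᗮ.orthogonalProjectionOnto x = 0 ↔ x ∈ ℝ ∙ v := fun x => by
    rw [Submodule.orthogonalProjectionOnto_eq_zero_iff, Submodule.orthogonal_orthogonal]
  refine exists_affine_reflection hW hKcomp hKconv hKint hv
    ((hker v).2 (Submodule.mem_span_singleton_self v)) (fun x hx => ?_) hsurj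
    (hasSymmetricSections_of_planes hW hsurj hsym)
  obtain ⟨s, hs⟩ := Submodule.mem_span_singleton.1 ((hker x).1 hx)
  exact ⟨s, hs.symm⟩
end

section
/- Let B be a convex body in the plane ℝ² and let p, q be points in the interior of B. Suppose that for every unit vector v, writing the chord (p + ℝ·v) ∩ B = [p - α·v, p + β·v] with α, β > 0 and the chord (q + ℝ·v) ∩ B = [q - γ·v, q + δ·v] with γ, δ > 0, one has: (1) α + β = γ + δ (equal chord lengths), and (2) the ratio in which p divides its chord is the reciprocal of the ratio in which q divides its chord, i.e. (α/β)·(γ/δ) = 1. Then B is centrally symmetric with center the midpoint (p + q)/2. -/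
/-- The line through `p` with direction `v`. -/
def lineThrough (p v : EuclideanSpace ℝ (Fin 2)) : Set (EuclideanSpace ℝ (Fin 2)) :=
  {x | ∃ t : ℝ, x = p + t • v}

/-- The parameters of the points of a compact convex set on a line through an interior point form
a compact interval around `0`. -/
lemma exists_mem_iff_mem_Icc {E : Type*} [NormedAddCommGroup E] [NormedSpace ℝ E] {B : Set E}
    (hc : IsCompact B) (hconv : Convex ℝ B) {p v : E} (hp : p ∈ interior B) (hv : ‖v‖ = 1) :
    ∃ α β : ℝ, 0 < α ∧ 0 < β ∧ ∀ t : ℝ, p + t • v ∈ B ↔ t ∈ Set.Icc (-α) β := by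
  set f : ℝ → E := fun t => p + t • v with hf
  have hiso : Isometry f := Isometry.of_dist_eq fun x y => by
    simp [hf, dist_eq_norm, ← sub_smul, norm_smul, hv]
  have hTc : IsCompact (f ⁻¹' B) := hiso.isClosedEmbedding.isCompact_preimage hc
  have hTconv : Convex ℝ (f ⁻¹' B) :=
    (hconv.translate_preimage_right p).linear_preimage (LinearMap.toSpanSingleton ℝ E v)
  have hnhds : f ⁻¹' B ∈ nhds (0 : ℝ) :=
    hiso.continuous.continuousAt.preimage_mem_nhds (by
      simpa [hf] using mem_interior_iff_mem_nhds.mp hp)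
  have hne : (f ⁻¹' B).Nonempty := ⟨0, mem_of_mem_nhds hnhds⟩
  have hIcc := eq_Icc_of_connected_compact ⟨hne, hTconv.isPreconnected⟩ hTc
  rw [hIcc, Icc_mem_nhds_iff] at hnhds
  refine ⟨-sInf (f ⁻¹' B), sSup (f ⁻¹' B), neg_pos.mpr hnhds.1, hnhds.2, fun t => ?_⟩
  rw [neg_neg, ← hIcc]
  rfl

lemma lineThrough_inter_eq_segment {B : Set (EuclideanSpace ℝ (Fin 2))}
    {p v : EuclideanSpace ℝ (Fin 2)} {α β : ℝ} (hα : 0 < α) (hβ : 0 < β)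
    (h : ∀ t : ℝ, p + t • v ∈ B ↔ t ∈ Set.Icc (-α) β) :
    lineThrough p v ∩ B = segment ℝ (p - α • v) (p + β • v) := by
  have himage := image_segment ℝ (AffineMap.lineMap (k := ℝ) p (p + v)) (-α) β
  rw [segment_eq_Icc (by linarith)] at himage
  simp only [AffineMap.lineMap_apply, vsub_eq_sub, add_sub_cancel_left, vadd_eq_add] at himage
  rw [sub_eq_neg_add, ← neg_smul, add_comm p, ← himage]
  ext x
  constructor
  · rintro ⟨⟨t, rfl⟩, hx⟩
    exact ⟨t, (h t).mp hx, by simp [AffineMap.lineMap_apply, add_comm]⟩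
  · rintro ⟨t, ht, rfl⟩
    have heq : AffineMap.lineMap p (p + v) t = p + t • v := by
      simp [AffineMap.lineMap_apply, add_comm]
    exact ⟨⟨t, heq⟩, heq ▸ (h t).mpr ht⟩

/-- Let `B ⊆ ℝ²` be a convex body and `p, q` interior points. If for every unit vector `v`,
writing the chords through `p` and `q` in direction `v` as `[p - α•v, p + β•v]` and
`[q - γ•v, q + δ•v]` (with `α, β, γ, δ > 0`), one has equal chord lengths `α + β = γ + δ` and
reciprocal division ratios `(α/β)·(γ/δ) = 1`, then `B` is centrally symmetric with center the
midpoint of `p` and `q` (i.e. reflection `x ↦ p + q - x` preserves `B`). -/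
theorem symmetric_of_chord_conditions
    (B : Set (EuclideanSpace ℝ (Fin 2)))
    (hBcomp : IsCompact B) (hBconv : Convex ℝ B) (hBint : (interior B).Nonempty)
    (p q : EuclideanSpace ℝ (Fin 2)) (hp : p ∈ interior B) (hq : q ∈ interior B)
    (h : ∀ v : EuclideanSpace ℝ (Fin 2), ‖v‖ = 1 →
      ∀ α β γ δ : ℝ, 0 < α → 0 < β → 0 < γ → 0 < δ →
        lineThrough p v ∩ B = segment ℝ (p - α • v) (p + β • v) →
        lineThrough q v ∩ B = segment ℝ (q - γ • v) (q + δ • v) →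
        α + β = γ + δ ∧ (α / β) * (γ / δ) = 1) :
    (fun x => p + q - x) '' B = B := by
  have hmem : ∀ x ∈ B, p + q - x ∈ B := by
    intro x hx
    rcases eq_or_ne x p with rfl | hxp
    · simpa using interior_subset hq
    have hn : ‖x - p‖ ≠ 0 := norm_ne_zero_iff.mpr (sub_ne_zero.mpr hxp)
    obtain ⟨v, hv, t, rfl⟩ : ∃ v : EuclideanSpace ℝ (Fin 2), ‖v‖ = 1 ∧ ∃ t : ℝ, x = p + t • v :=
      ⟨‖x - p‖⁻¹ • (x - p), by rw [norm_smul, norm_inv, norm_norm, inv_mul_cancel₀ hn],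
        ‖x - p‖, by rw [smul_inv_smul₀ hn, add_sub_cancel]⟩
    obtain ⟨α, β, hα, hβ, hpB⟩ := exists_mem_iff_mem_Icc hBcomp hBconv hp hv
    obtain ⟨γ, δ, hγ, hδ, hqB⟩ := exists_mem_iff_mem_Icc hBcomp hBconv hq hv
    obtain ⟨hsum, hratio⟩ := h v hv α β γ δ hα hβ hγ hδ
      (lineThrough_inter_eq_segment hα hβ hpB) (lineThrough_inter_eq_segment hγ hδ hqB)
    have hprod : α * γ = β * δ := by
      field_simp at hratio
      linarith
    have hβγ : β = γ := mul_right_cancel₀ (add_pos hα hβ).ne' (by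
      linear_combination β * hsum - hprod)
    have hαδ : α = δ := by linarith
    have ht := (hpB t).mp hx
    have hrefl : p + q - (p + t • v) = q + (-t) • v := by
      rw [neg_smul]
      abel
    rw [hrefl, hqB, ← hβγ, ← hαδ]
    exact ⟨neg_le_neg ht.2, neg_le.mp ht.1⟩
  refine Set.Subset.antisymm (Set.image_subset_iff.mpr hmem) fun x hx => ?_
  exact ⟨p + q - x, hmem x hx, sub_sub_cancel _ _⟩
end

section
/- Let B be a strictly convex body in a 2-dimensional affine subspace of ℝⁿ (or in ℝ²) that is centrally symmetric with center c. Let v be a nonzero vector parallel to the plane of B, and let a, b be two points such that the chords B ∩ (a + ℝ·v) and B ∩ (b + ℝ·v) are nondegenerate segments of equal length lying on distinct lines. Then B ∩ (b + ℝ·v) = 2·c - (B ∩ (a + ℝ·v)); in particular, the center c lies on the parallel line through the midpoint of the segment joining the midpoints of the two chords. -/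
open Set Topology

/-- A convex set whose frontier contains no nondegenerate segment is strictly convex. -/
theorem Convex.strictConvex_of_segment_not_subset_frontier {E : Type*} [NormedAddCommGroup E]
    [NormedSpace ℝ E] {B : Set E} (hconv : Convex ℝ B)
    (h : ∀ x y : E, x ≠ y → ¬ segment ℝ x y ⊆ frontier B) : StrictConvex ℝ B := by
  refine hconv.strictConvex' fun x hx y hy hxy => ?_
  obtain ⟨w, hw, hwB⟩ := not_subset.1 (h x y hxy)
  have hint : w ∈ interior B := by
    by_contra hwi
    exact hwB ⟨subset_closure (hconv.segment_subset hx.1 hy.1 hw), hwi⟩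
  rw [segment_eq_image_lineMap] at hw
  obtain ⟨t, -, rfl⟩ := hw
  exact ⟨t, hint⟩

/-- The points `p` and `p + s • v` are the two ends of the chord of `B` through `p` with
direction `v`. -/
structure IsChordStart {E : Type*} [AddCommGroup E] [Module ℝ E] (B : Set E) (v : E) (s : ℝ)
    (p : E) : Prop where
  start_mem : p ∈ B
  end_mem : p + s • v ∈ B
  bounds : ∀ u : ℝ, p + u • v ∈ B → 0 ≤ u ∧ u ≤ s

namespace IsChordStart

variable {E : Type*}

theorem reflect [AddCommGroup E] [Module ℝ E] {B : Set E} {v p c : E} {s : ℝ}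
    (hp : IsChordStart B v s p) (hsym : ∀ x ∈ B, (2 : ℝ) • c - x ∈ B) :
    IsChordStart B v s ((2 : ℝ) • c - (p + s • v)) where
  start_mem := hsym _ hp.end_mem
  end_mem := by
    convert hsym _ hp.start_mem using 1
    module
  bounds u hu := by
    have h := hp.bounds (s - u) (by
      convert hsym _ hu using 1
      module)
    constructor <;> linarith [h.1, h.2]

theorem eq_of_eq_add_smul [AddCommGroup E] [Module ℝ E] {B : Set E} {v p q : E} {s u : ℝ}
    (hp : IsChordStart B v s p) (hq : IsChordStart B v s q) (h : q = p + u • v) : q = p := by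
  have h₁ := (hp.bounds u (h ▸ hq.start_mem)).1
  have h₂ := (hq.bounds (-u) (by
    convert hp.start_mem using 1
    rw [h]
    module)).1
  have : u = 0 := by linarith
  simpa [this] using h

/-- A chord strictly between two parallel chords of length `s` is strictly longer than `s`. -/
theorem ne_combo [NormedAddCommGroup E] [NormedSpace ℝ E] {B : Set E} {v p q r : E} {s t u : ℝ}
    (hB : StrictConvex ℝ B) (hp : IsChordStart B v s p) (hq : IsChordStart B v s q)
    (hr : IsChordStart B v s r) (hpq : p ≠ q) (ht₀ : 0 < t) (ht₁ : t < 1) :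
    r + u • v ≠ (1 - t) • p + t • q := by
  intro h
  have key : ∀ w : ℝ, r + w • v ∈ interior B → 0 < w ∧ w < s := by
    intro w hw
    have hcont : ContinuousAt (fun e : ℝ => r + e • v) w := by fun_prop
    have hev : ∀ᶠ e in 𝓝 w, r + e • v ∈ B :=
      (hcont.eventually_mem (isOpen_interior.mem_nhds hw)).mono fun _ he => interior_subset he
    obtain ⟨ε, hε, hball⟩ := Metric.eventually_nhds_iff.1 hev
    have h₁ := hr.bounds (w - ε / 2) (hball (by
      rw [Real.dist_eq, abs_lt]; constructor <;> linarith))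
    have h₂ := hr.bounds (w + ε / 2) (hball (by
      rw [Real.dist_eq, abs_lt]; constructor <;> linarith))
    constructor <;> linarith [h₁.1, h₂.2]
  have h₀ := key u (h ▸ hB hp.start_mem hq.start_mem hpq (sub_pos.2 ht₁) ht₀ (by ring))
  have h₁ := key (u + s) (by
    have := hB hp.end_mem hq.end_mem (fun h => hpq (add_right_cancel h)) (sub_pos.2 ht₁) ht₀
      (by ring)
    convert this using 1
    rw [add_smul, ← add_assoc, h]
    module)
  linarith [h₀.1, h₁.2]

end IsChordStart

/-- A linear functional on the plane whose kernel is spanned by `v`. -/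
def crossWith (v : EuclideanSpace ℝ (Fin 2)) : EuclideanSpace ℝ (Fin 2) →ₗ[ℝ] ℝ where
  toFun x := v 0 * x 1 - v 1 * x 0
  map_add' x y := by simp; ring
  map_smul' t x := by simp; ring

theorem crossWith_self (v : EuclideanSpace ℝ (Fin 2)) : crossWith v v = 0 := by
  simp [crossWith]; ring

theorem exists_eq_add_smul_of_crossWith_eq {v x y : EuclideanSpace ℝ (Fin 2)} (hv : v ≠ 0)
    (h : crossWith v x = crossWith v y) : ∃ u : ℝ, x = y + u • v := by
  have hsq : v 0 ^ 2 + v 1 ^ 2 ≠ 0 := by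
    intro h0
    apply hv
    ext i
    fin_cases i <;> simp <;> nlinarith [sq_nonneg (v 0), sq_nonneg (v 1)]
  have h' : v 0 * x 1 - v 1 * x 0 = v 0 * y 1 - v 1 * y 0 := h
  refine ⟨(v 0 * (x 0 - y 0) + v 1 * (x 1 - y 1)) / (v 0 ^ 2 + v 1 ^ 2), ?_⟩
  ext i
  fin_cases i
  · simp
    field_simp
    linear_combination (-v 1) * h'
  · simp
    field_simp
    linear_combination (v 0) * h'

/-- Of three parallel chords of a strictly convex set with the same length, none lies strictly
between the other two. -/
theorem IsChordStart.not_between {B : Set (EuclideanSpace ℝ (Fin 2))}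
    {v p q r : EuclideanSpace ℝ (Fin 2)} {s : ℝ} (hB : StrictConvex ℝ B) (hv : v ≠ 0)
    (hp : IsChordStart B v s p) (hq : IsChordStart B v s q) (hr : IsChordStart B v s r)
    (hpr : crossWith v p < crossWith v r) : ¬ crossWith v r < crossWith v q := by
  intro hrq
  have hpos : 0 < crossWith v q - crossWith v p := by linarith
  set t := (crossWith v r - crossWith v p) / (crossWith v q - crossWith v p) with ht
  have ht₀ : 0 < t := div_pos (by linarith) hpos
  have ht₁ : t < 1 := (div_lt_one hpos).2 (by linarith)
  obtain ⟨u, hu⟩ := exists_eq_add_smul_of_crossWith_eq (x := (1 - t) • p + t • q) (y := r) hv (by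
    simp only [map_add, map_smul, smul_eq_mul]
    rw [ht]
    field_simp
    ring)
  exact hp.ne_combo hB hq hr (fun h => by simp [h] at hpos) ht₀ ht₁ hu.symm

theorem exists_isChordStart {B : Set (EuclideanSpace ℝ (Fin 2))}
    {v a a₁ a₂ : EuclideanSpace ℝ (Fin 2)}
    (ha : B ∩ lineThrough a v = segment ℝ a₁ a₂) (hne : a₁ ≠ a₂) :
    ∃ (p : EuclideanSpace ℝ (Fin 2)) (s : ℝ), IsChordStart B v s p ∧
      segment ℝ a₁ a₂ = segment ℝ p (p + s • v) ∧
      midpoint ℝ a₁ a₂ = p + (s / 2) • v ∧ dist a₁ a₂ = s * ‖v‖ ∧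
      ∃ t : ℝ, p = a + t • v := by
  obtain ⟨-, t₁, h₁⟩ := ha ▸ left_mem_segment ℝ a₁ a₂
  obtain ⟨-, t₂, h₂⟩ := ha ▸ right_mem_segment ℝ a₁ a₂
  wlog hlt : t₁ < t₂ generalizing a₁ a₂ t₁ t₂
  · have hlt' : t₂ < t₁ := lt_of_le_of_ne (not_lt.1 hlt) fun h => hne (by rw [h₁, h₂, h])
    have := this (a₁ := a₂) (a₂ := a₁) (by rw [ha, segment_symm]) hne.symm t₂ h₂ t₁ h₁ hlt'
    rwa [segment_symm, midpoint_comm, dist_comm] at this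
  have hv : v ≠ 0 := fun h => hne (by rw [h₁, h₂, h]; simp)
  have h₃ : a₂ = a₁ + (t₂ - t₁) • v := by rw [h₁, h₂]; module
  refine ⟨a₁, t₂ - t₁, ⟨?_, ?_, ?_⟩, by rw [← h₃], ?_, ?_, t₁, h₁⟩
  · exact (ha.symm ▸ left_mem_segment ℝ a₁ a₂ : a₁ ∈ B ∩ lineThrough a v).1
  · rw [← h₃]
    exact (ha.symm ▸ right_mem_segment ℝ a₁ a₂ : a₂ ∈ B ∩ lineThrough a v).1
  · intro u hu
    have hmem : a₁ + u • v ∈ segment ℝ a₁ a₂ := by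
      rw [← ha]
      exact ⟨hu, t₁ + u, by rw [h₁]; module⟩
    rw [segment_eq_image'] at hmem
    obtain ⟨θ, ⟨hθ₀, hθ₁⟩, hθ⟩ := hmem
    have hθ' : (θ * (t₂ - t₁)) • v = u • v := by
      have : θ • (a₂ - a₁) = u • v := add_left_cancel hθ
      rw [← this, h₃]
      module
    have hu' : θ * (t₂ - t₁) = u := smul_left_injective ℝ hv hθ'
    constructor <;> nlinarith
  · rw [midpoint_eq_smul_add, h₃, invOf_eq_inv]
    module
  · rw [h₃, dist_self_add_right, norm_smul, Real.norm_of_nonneg (by linarith)]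

/-- Let `B ⊆ ℝ²` be a strictly convex body (its boundary contains no nondegenerate segment),
centrally symmetric with center `c`. If two chords of `B` in the same direction `v` are
nondegenerate segments of equal length lying on distinct lines, then one chord is the reflection
of the other through `c`; in particular `c` lies on the line with direction `v` through the
midpoint of the segment joining the midpoints of the two chords. -/
theorem equal_parallel_chords_reflect
    (B : Set (EuclideanSpace ℝ (Fin 2)))
    (hBcomp : IsCompact B) (hBconv : Convex ℝ B) (hBint : (interior B).Nonempty)
    (hstrict : ∀ x y : EuclideanSpace ℝ (Fin 2), x ≠ y → ¬ segment ℝ x y ⊆ frontier B)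
    (c : EuclideanSpace ℝ (Fin 2))
    (hsym : (fun x => (2 : ℝ) • c - x) '' B = B)
    (v : EuclideanSpace ℝ (Fin 2)) (hv : v ≠ 0)
    (a b a₁ a₂ b₁ b₂ : EuclideanSpace ℝ (Fin 2))
    (ha : B ∩ lineThrough a v = segment ℝ a₁ a₂) (ha' : a₁ ≠ a₂)
    (hb : B ∩ lineThrough b v = segment ℝ b₁ b₂) (hb' : b₁ ≠ b₂)
    (hlen : dist a₁ a₂ = dist b₁ b₂)
    (hlines : lineThrough a v ≠ lineThrough b v) :
    B ∩ lineThrough b v = (fun x => (2 : ℝ) • c - x) '' (B ∩ lineThrough a v) ∧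
      c ∈ lineThrough (midpoint ℝ (midpoint ℝ a₁ a₂) (midpoint ℝ b₁ b₂)) v := by
  have hB := hBconv.strictConvex_of_segment_not_subset_frontier hstrict
  have hrefl : ∀ x ∈ B, (2 : ℝ) • c - x ∈ B := fun x hx => hsym ▸ mem_image_of_mem _ hx
  obtain ⟨p, s, hp, hpseg, hpmid, hpdist, t, hpt⟩ := exists_isChordStart ha ha'
  obtain ⟨q, s', hq, hqseg, hqmid, hqdist, t', hqt⟩ := exists_isChordStart hb hb'
  obtain rfl : s = s' :=
    mul_right_cancel₀ (norm_ne_zero_iff.2 hv) (by rw [← hpdist, ← hqdist, hlen])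
  have hp' := hp.reflect hrefl
  have hq' := hq.reflect hrefl
  have hfr : ∀ x, crossWith v ((2 : ℝ) • c - (x + s • v)) = 2 * crossWith v c - crossWith v x := by
    intro x
    simp [crossWith_self]
  have hpq : crossWith v p ≠ crossWith v q := by
    intro h
    obtain ⟨u, hu⟩ := exists_eq_add_smul_of_crossWith_eq hv h
    apply hlines
    ext x
    constructor
    · rintro ⟨w, rfl⟩
      refine ⟨w - t + u + t', ?_⟩
      linear_combination (norm := module) hu - hpt + hqt
    · rintro ⟨w, rfl⟩
      refine ⟨w - t' - u + t, ?_⟩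
      linear_combination (norm := module) hpt - hu - hqt
  have hsum : crossWith v q = 2 * crossWith v c - crossWith v p := by
    have h₁ := hq.not_between hB hv hq' hp
    have h₂ := hq'.not_between hB hv hq hp
    have h₃ := hp.not_between hB hv hp' hq
    have h₄ := hp'.not_between hB hv hp hq
    rw [hfr] at h₁ h₂ h₃ h₄
    by_contra h
    rcases lt_or_gt_of_ne hpq with h₅ | h₅ <;> rcases lt_or_gt_of_ne h with h₆ | h₆
    · exact h₃ h₅ h₆
    · exact h₂ (by linarith) h₅
    · exact h₁ h₅ (by linarith)
    · exact h₄ h₆ h₅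
  obtain ⟨u, hu⟩ := exists_eq_add_smul_of_crossWith_eq hv (hsum.trans (hfr p).symm)
  have hqp := hp'.eq_of_eq_add_smul hq hu
  constructor
  · rw [ha, hb, hpseg, hqseg, hqp]
    have himg := image_segment ℝ (AffineEquiv.pointReflection ℝ c).toAffineMap p (p + s • v)
    have hfun : ⇑(AffineEquiv.pointReflection ℝ c).toAffineMap = fun x => (2 : ℝ) • c - x := by
      funext x
      rw [AffineEquiv.coe_toAffineMap, AffineEquiv.pointReflection_apply, vsub_eq_sub, vadd_eq_add]
      module
    rw [hfun] at himg
    rw [himg, segment_symm]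
    congr 1
    module
  · refine ⟨0, ?_⟩
    rw [hpmid, hqmid, hqp, midpoint_eq_smul_add, invOf_eq_inv]
    module
end

section
/- Let K be a convex body in ℝ³ that is centrally symmetric with center the origin (K = -K), let H be a plane through the origin and let p ∉ H be a point such that the section (p + H) ∩ K is centrally symmetric with center v. Let L ⊆ H be a line through the origin with v ∉ L, let Γ be the plane spanned by L and v, and suppose K is strictly convex, the chord (p + L) ∩ K is a nondegenerate segment, and the section (p + Γ) ∩ K is centrally symmetric with center c. Then c lies on the line (p - v) + L. -/
open scoped Pointwise

/-- The line through `x + t • v` in direction `u` meets `K` in a chord which is a translate of the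
segment from `0` to `u`. -/
def HasChordAt {E : Type*} [AddCommGroup E] [Module ℝ E] (K : Set E) (x u v : E) (t : ℝ) : Prop :=
  ∃ m : ℝ, x + t • v + m • u ∈ K ∧ x + t • v + (m + 1) • u ∈ K ∧
    ∀ r s : ℝ, x + t • v + r • u ∈ K → x + t • v + s • u ∈ K → s - r ≤ 1

/-- A chord property transfers along a point reflection in the plane of the chords. -/
theorem HasChordAt.reflect {E : Type*} [AddCommGroup E] [Module ℝ E] {K : Set E} {x u v : E}
    {a m t : ℝ}
    (h : ∀ t s : ℝ, x + t • v + s • u ∈ K → x + (a - t) • v + (m - s) • u ∈ K)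
    (ht : HasChordAt K x u v t) : HasChordAt K x u v (a - t) := by
  obtain ⟨k, h₀, h₁, hle⟩ := ht
  refine ⟨m - (k + 1), h _ _ h₁, ?_, fun r s hr hs => ?_⟩
  · have := h _ _ h₀
    rwa [show m - k = m - (k + 1) + 1 by ring] at this
  · have hr' := h _ _ hr
    have hs' := h _ _ hs
    rw [sub_sub_cancel] at hr' hs'
    linarith [hle _ _ hs' hr']

/-- A strictly convex set does not have three parallel coplanar chords of equal length. -/
theorem StrictConvex.not_three_chords {E : Type*} [AddCommGroup E] [Module ℝ E]
    [TopologicalSpace E] [ContinuousAdd E] [ContinuousSMul ℝ E] {K : Set E}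
    (hK : StrictConvex ℝ K) {x u v : E} (huv : ∀ k : ℝ, v ≠ k • u) {t₀ t₁ t₂ : ℝ}
    (h₀₁ : t₀ < t₁) (h₁₂ : t₁ < t₂) (h₀ : HasChordAt K x u v t₀) (h₁ : HasChordAt K x u v t₁)
    (h₂ : HasChordAt K x u v t₂) : False := by
  obtain ⟨m₀, ha₀, hb₀, -⟩ := h₀
  obtain ⟨m₂, ha₂, hb₂, -⟩ := h₂
  obtain ⟨-, -, -, hle⟩ := h₁
  have hd : t₂ - t₀ ≠ 0 := by linarith
  have hne : ∀ j k : ℝ, x + t₀ • v + j • u ≠ x + t₂ • v + k • u := by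
    intro j k h
    apply huv ((t₂ - t₀)⁻¹ * (j - k))
    rw [mul_smul, eq_inv_smul_iff₀ hd]
    linear_combination (norm := module) -h
  set θ := (t₁ - t₀) / (t₂ - t₀) with hθ
  have hθ₀ : 0 < θ := div_pos (by linarith) (by linarith)
  have hθ₁ : 0 < 1 - θ := by
    rw [hθ, sub_pos, div_lt_one (by linarith)]
    linarith
  have ht : (1 - θ) * t₀ + θ * t₂ = t₁ := by
    rw [hθ]
    field_simp
    ring
  have hcomb : ∀ j k : ℝ, (1 - θ) • (x + t₀ • v + j • u) + θ • (x + t₂ • v + k • u) =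
      x + t₁ • v + ((1 - θ) * j + θ * k) • u := by
    intro j k
    rw [← ht]
    module
  have ha := hK ha₀ ha₂ (hne _ _) hθ₁ hθ₀ (by ring)
  have hb := hK hb₀ hb₂ (hne _ _) hθ₁ hθ₀ (by ring)
  simp only [hcomb] at ha hb
  set m := (1 - θ) * m₀ + θ * m₂ with hm
  rw [show (1 - θ) * (m₀ + 1) + θ * (m₂ + 1) = m + 1 by rw [hm]; ring] at hb
  have hcont : Continuous fun s : ℝ => x + t₁ • v + s • u := by fun_prop
  have hev := hcont.continuousAt.preimage_mem_nhds (mem_interior_iff_mem_nhds.1 hb)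
  obtain ⟨ε, hε, hball⟩ := Metric.mem_nhds_iff.1 hev
  have hmem : m + 1 + ε / 2 ∈ Metric.ball (m + 1) ε := by
    rw [Metric.mem_ball, Real.dist_eq, add_sub_cancel_left, abs_of_pos (by linarith)]
    linarith
  linarith [hle _ _ (interior_subset ha) (hball hmem)]

theorem SymmWith.mem {A : Set (EuclideanSpace ℝ (Fin 3))} {c x : EuclideanSpace ℝ (Fin 3)}
    (h : SymmWith A c) (hx : x ∈ A) : (2 : ℝ) • c - x ∈ A :=
  h.subset ⟨x, hx, rfl⟩

theorem mem_vadd_submodule_iff {E : Type*} [AddCommGroup E] [Module ℝ E] {S : Submodule ℝ E}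
    {p z : E} : z ∈ p +ᵥ (S : Set E) ↔ z - p ∈ S := by
  rw [Set.mem_vadd_set_iff_neg_vadd_mem, vadd_eq_add, neg_add_eq_sub, SetLike.mem_coe]

/-- The centre of a symmetric section lies in the plane of the section. -/
theorem SymmWith.sub_mem {K : Set (EuclideanSpace ℝ (Fin 3))}
    {S : Submodule ℝ (EuclideanSpace ℝ (Fin 3))} {p c x : EuclideanSpace ℝ (Fin 3)}
    (h : SymmWith ((p +ᵥ (S : Set (EuclideanSpace ℝ (Fin 3)))) ∩ K) c) (hxS : x - p ∈ S)
    (hxK : x ∈ K) : c - p ∈ S := by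
  have h₁ := mem_vadd_submodule_iff.1 (h.mem ⟨mem_vadd_submodule_iff.2 hxS, hxK⟩).1
  have h₂ := S.smul_mem (1 / 2 : ℝ) (S.add_mem h₁ hxS)
  convert h₂ using 1
  module

/-- Let `K ⊆ ℝ³` be a strictly convex body symmetric about the origin, `H` a plane through the
origin and `p ∉ H` a point such that the section `(p + H) ∩ K` is centrally symmetric with
center `v`. Let `L ⊆ H` be a line through the origin with `v ∉ L` and let `Γ` be the plane
spanned by `L` and `v`. If the chord `(p + L) ∩ K` is a nondegenerate segment and the section
`(p + Γ) ∩ K` is centrally symmetric with center `c`, then `c` lies on the line `(p - v) + L`. -/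
theorem centre_on_mid_chord_line
    (K : Set (EuclideanSpace ℝ (Fin 3)))
    (hKcomp : IsCompact K) (hKconv : Convex ℝ K) (hKint : (interior K).Nonempty)
    (hstrict : ∀ x y : EuclideanSpace ℝ (Fin 3), x ≠ y → ¬ segment ℝ x y ⊆ frontier K)
    (hK0 : -K = K)
    (H : Submodule ℝ (EuclideanSpace ℝ (Fin 3))) (hH : Module.finrank ℝ H = 2)
    (p : EuclideanSpace ℝ (Fin 3)) (hp : p ∉ H)
    (v : EuclideanSpace ℝ (Fin 3))
    (hv : SymmWith ((p +ᵥ (H : Set (EuclideanSpace ℝ (Fin 3)))) ∩ K) v)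
    (L : Submodule ℝ (EuclideanSpace ℝ (Fin 3)))
    (hL : Module.finrank ℝ L = 1) (hLH : L ≤ H) (hvL : v ∉ L)
    (hchord : ∃ x y : EuclideanSpace ℝ (Fin 3), x ≠ y ∧
      (p +ᵥ (L : Set (EuclideanSpace ℝ (Fin 3)))) ∩ K = segment ℝ x y)
    (c : EuclideanSpace ℝ (Fin 3))
    (hc : SymmWith
      ((p +ᵥ ((L ⊔ Submodule.span ℝ {v} : Submodule ℝ (EuclideanSpace ℝ (Fin 3))) :
        Set (EuclideanSpace ℝ (Fin 3)))) ∩ K) c) :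
    c ∈ (p - v) +ᵥ (L : Set (EuclideanSpace ℝ (Fin 3))) := by
  have hKs : StrictConvex ℝ K := by
    refine hKconv.strictConvex fun x _ y _ hxy => ?_
    exact Set.sdiff_nonempty.2 (hstrict x y hxy)
  have hneg : ∀ z ∈ K, -z ∈ K := fun z hz => by
    rw [← hK0]
    simpa using hz
  obtain ⟨x, y, hxy, hseg⟩ := hchord
  obtain ⟨hxL, hxK⟩ := hseg.ge (left_mem_segment ℝ x y)
  obtain ⟨hyL, hyK⟩ := hseg.ge (right_mem_segment ℝ x y)
  rw [mem_vadd_submodule_iff] at hxL hyL ⊢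
  obtain ⟨u, rfl⟩ : ∃ u, y = x + u := ⟨y - x, by abel⟩
  have hu : u ≠ 0 := by
    rintro rfl
    simp at hxy
  have huL : u ∈ L := by
    convert L.sub_mem hyL hxL using 1
    abel
  have hspan : ∀ w ∈ L, ∃ k : ℝ, k • u = w := fun w hw => by
    obtain ⟨k, hk⟩ := exists_smul_eq_of_finrank_eq_one hL (x := (⟨u, huL⟩ : L))
      (by simpa [Subtype.ext_iff] using hu) ⟨w, hw⟩
    exact ⟨k, congrArg Subtype.val hk⟩
  have huv : ∀ k : ℝ, v ≠ k • u := by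
    rintro k rfl
    exact hvL (L.smul_mem k huL)
  have hline : ∀ s : ℝ, x + s • u - p ∈ L := fun s => by
    convert L.add_mem hxL (L.smul_mem s huL) using 1
    abel
  have hchord₀ : HasChordAt K x u v 0 := by
    have key : ∀ s : ℝ, x + (0 : ℝ) • v + s • u ∈ K → 0 ≤ s ∧ s ≤ 1 := by
      intro s hs
      rw [zero_smul, add_zero] at hs
      have hs' := hseg.le ⟨mem_vadd_submodule_iff.2 (hline s), hs⟩
      rw [segment_eq_image'] at hs'
      obtain ⟨θ, ⟨hθ₀, hθ₁⟩, hθ⟩ := hs'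
      rw [add_sub_cancel_left] at hθ
      have hθs : θ = s := smul_left_injective ℝ hu (add_left_cancel hθ)
      exact hθs ▸ ⟨hθ₀, hθ₁⟩
    refine ⟨0, by simpa using hxK, by simpa using hyK, fun r s hr hs => ?_⟩
    linarith [(key r hr).1, (key s hs).2]
  have hvH := hv.sub_mem (hLH hxL) hxK
  have hfwd : ∀ s : ℝ, x + (0 : ℝ) • v + s • u ∈ K → x + (-2 : ℝ) • v + s • u ∈ K := by
    intro s hs
    rw [zero_smul, add_zero] at hs
    have := hneg _ (hv.mem ⟨mem_vadd_submodule_iff.2 (hLH (hline s)), hs⟩).2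
    convert this using 1
    module
  have hbwd : ∀ s : ℝ, x + (-2 : ℝ) • v + s • u ∈ K → x + (0 : ℝ) • v + s • u ∈ K := by
    intro s hs
    have hmem : -(x + (-2 : ℝ) • v + s • u) - p ∈ H := by
      convert H.sub_mem (H.smul_mem 2 hvH) (hLH (hline s)) using 1
      module
    have := (hv.mem ⟨mem_vadd_submodule_iff.2 hmem, hneg _ hs⟩).2
    convert this using 1
    module
  have hchord₂ : HasChordAt K x u v (-2) := by
    obtain ⟨m, h₀, h₁, hle⟩ := hchord₀
    exact ⟨m, hfwd _ h₀, hfwd _ h₁, fun r s hr hs => hle r s (hbwd r hr) (hbwd s hs)⟩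
  have hcΓ := hc.sub_mem (Submodule.mem_sup_left hxL) hxK
  obtain ⟨w, hw, w', hw', hww⟩ := Submodule.mem_sup.1 hcΓ
  obtain ⟨a, rfl⟩ := Submodule.mem_span_singleton.1 hw'
  obtain ⟨k, hk⟩ := hspan _ hw
  obtain ⟨l, hl⟩ := hspan _ hxL
  have hcx : (2 : ℝ) • c - x = x + (2 * a) • v + (2 * k - 2 * l) • u := by
    rw [← hk] at hww
    linear_combination (norm := module) (-2 : ℝ) • hww + (2 : ℝ) • hl
  have hrefl : ∀ t s : ℝ, x + t • v + s • u ∈ K →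
      x + (2 * a - t) • v + (2 * k - 2 * l - s) • u ∈ K := by
    intro t s hts
    have hmem : x + t • v + s • u - p ∈ L ⊔ Submodule.span ℝ {v} := by
      convert add_mem (Submodule.mem_sup_left (hline s))
        (Submodule.mem_sup_right
          (Submodule.smul_mem _ t (Submodule.mem_span_singleton_self v))) using 1
      abel
    convert (hc.mem ⟨mem_vadd_submodule_iff.2 hmem, hts⟩).2 using 1
    linear_combination (norm := module) -hcx
  have ha : a = -1 := by
    rcases lt_trichotomy a 0 with h | rfl | h
    · have hchord₁ := hchord₀.reflect hrefl
      rw [sub_zero] at hchord₁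
      rcases lt_trichotomy a (-1) with h' | h' | h'
      · exact (hKs.not_three_chords huv (by linarith) (by norm_num) hchord₁ hchord₂ hchord₀).elim
      · exact h'
      · exact (hKs.not_three_chords huv (by linarith) (by linarith)
          hchord₂ hchord₁ hchord₀).elim
    · exact (hKs.not_three_chords huv (by norm_num) (by norm_num) hchord₂ hchord₀
        (hchord₂.reflect hrefl)).elim
    · have hchord₁ := hchord₀.reflect hrefl
      exact (hKs.not_three_chords huv (by norm_num) (by linarith) hchord₂ hchord₀ hchord₁).elim
  subst ha
  convert hw using 1
  linear_combination (norm := module) -hww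
end
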